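/- arXiv:2510.16385 — 5 statements merged into one kernel-verified Lean document; each statement's English description precedes it below -/
import Mathlib

section
/- Let G=(V,E) be a finite simple undirected graph with preferences as described, and let x be an element of P all of whose coordinates are 0 or 1. Then μ := {e∈E : x(e)=1} is a strongly stable matching in G. -/
/-!
Common setup: a finite simple undirected graph `G = (V, E)` where edges are
elements of `Sym2 V`, together with, for each vertex `v`, a complete and
transitive preference relation `pref v` on `E(v) ∪ {∅}` (the unmatched
option `∅` is encoded as `none : Option (Sym2 V)`), where every incident
edge is strictly preferred to `∅`.
-/

/-- A roommates instance: a finite simple graph with preferences. -/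
structure RSetup (V : Type*) [Fintype V] [DecidableEq V] where
  /-- the edge set -/
  E : Finset (Sym2 V)
  /-- the graph is simple: no loops -/
  not_diag : ∀ e ∈ E, ¬ e.IsDiag
  /-- the preference relation `≿ᵥ` of each vertex, on `E(v) ∪ {∅}` -/
  pref : V → Option (Sym2 V) → Option (Sym2 V) → Prop
  /-- completeness of `≿ᵥ` on `E(v) ∪ {∅}` -/
  pref_total : ∀ v : V, ∀ a b : Option (Sym2 V),
    (∀ e, a = some e → e ∈ E ∧ v ∈ e) → (∀ e, b = some e → e ∈ E ∧ v ∈ e) →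
    pref v a b ∨ pref v b a
  /-- transitivity of `≿ᵥ` on `E(v) ∪ {∅}` -/
  pref_trans : ∀ v : V, ∀ a b c : Option (Sym2 V),
    (∀ e, a = some e → e ∈ E ∧ v ∈ e) → (∀ e, b = some e → e ∈ E ∧ v ∈ e) →
    (∀ e, c = some e → e ∈ E ∧ v ∈ e) →
    pref v a b → pref v b c → pref v a c
  /-- every incident edge is strictly preferred to being unmatched -/
  pref_none : ∀ v : V, ∀ e ∈ E, v ∈ e →
    pref v (some e) none ∧ ¬ pref v none (some e)

namespace RSetup

variable {V : Type*} [Fintype V] [DecidableEq V] (S : RSetup V)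

/-- `a ≻ᵥ b` : strict preference. -/
def SPref (v : V) (a b : Option (Sym2 V)) : Prop :=
  S.pref v a b ∧ ¬ S.pref v b a

/-- `a ∼ᵥ b` : indifference. -/
def IPref (v : V) (a b : Option (Sym2 V)) : Prop :=
  S.pref v a b ∧ S.pref v b a

/-- `F(v)` : the set of edges in `F` incident to `v`. -/
def inc (F : Finset (Sym2 V)) (v : V) : Finset (Sym2 V) :=
  F.filter (fun e => v ∈ e)

/-- a matching in `G` -/
def IsMatching (μ : Finset (Sym2 V)) : Prop :=
  μ ⊆ S.E ∧ ∀ v : V, (inc μ v).card ≤ 1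

/-- `μ(v)` : the edge of `μ` incident to `v` (or `none`). -/
noncomputable def matchOf (μ : Finset (Sym2 V)) (v : V) : Option (Sym2 V) :=
  (inc μ v).toList.head?

/-- `e` blocks the matching `μ`. -/
def Blocks (μ : Finset (Sym2 V)) (e : Sym2 V) : Prop :=
  e ∈ S.E ∧ e ∉ μ ∧ (∀ v ∈ e, S.pref v (some e) (matchOf μ v)) ∧
    (∃ v ∈ e, S.SPref v (some e) (matchOf μ v))

/-- a strongly stable matching in `G` -/
def StronglyStable (μ : Finset (Sym2 V)) : Prop :=
  S.IsMatching μ ∧ ∀ e : Sym2 V, ¬ S.Blocks μ e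

/-- `x(W) = ∑_{e ∈ W} x(e)` -/
def xS (x : Sym2 V → ℝ) (W : Finset (Sym2 V)) : ℝ := ∑ e ∈ W, x e

/-- `x ∈ ℝ₊^E`, encoded as a nonnegative function on `Sym2 V` vanishing
outside `E`. -/
def IsVec (x : Sym2 V → ℝ) : Prop :=
  (∀ e, 0 ≤ x e) ∧ ∀ e ∉ S.E, x e = 0

open Classical in
/-- `E[∼ᵥ e] = {f ∈ E(v) : f ∼ᵥ e}` -/
noncomputable def simSet (v : V) (e : Sym2 V) : Finset (Sym2 V) :=
  (inc S.E v).filter (fun f => S.IPref v (some f) (some e))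

open Classical in
/-- `E[≻ᵥ e] = {f ∈ E(v) : f ≻ᵥ e}` -/
noncomputable def succSet (v : V) (e : Sym2 V) : Finset (Sym2 V) :=
  (inc S.E v).filter (fun f => S.SPref v (some f) (some e))

open Classical in
/-- `E⟨X⟩ = {e ∈ E : e ⊆ X}` -/
noncomputable def esub (X : Finset V) : Finset (Sym2 V) :=
  S.E.filter (fun e => ∀ u ∈ e, u ∈ X)

/-- constraint (1): `x(E(v)) ≤ 1` for every vertex `v` -/
def C1 (x : Sym2 V → ℝ) : Prop := ∀ v : V, xS x (inc S.E v) ≤ 1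

/-- constraint (2): `x(E[∼ᵥ e]) + ∑_{w ∈ e} x(E[≻_w e]) ≥ 1`
for every edge `e ∈ E` and `v ∈ e` -/
def C2 (x : Sym2 V → ℝ) : Prop := ∀ v w : V, s(v, w) ∈ S.E →
  xS x (S.simSet v s(v, w)) +
    (xS x (S.succSet v s(v, w)) + xS x (S.succSet w s(v, w))) ≥ 1

/-- constraint (3): `x(E⟨X⟩) ≤ ⌊|X|/2⌋` for every odd `X ⊆ V` -/
def C3 (x : Sym2 V → ℝ) : Prop := ∀ X : Finset V, Odd X.card →
  xS x (S.esub X) ≤ ((X.card / 2 : ℕ) : ℝ)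

/-- membership in the polytope `P` -/
def memP (x : Sym2 V → ℝ) : Prop := S.IsVec x ∧ S.C1 x ∧ S.C2 x ∧ S.C3 x

/-- the characteristic vector `χ_μ` of a set of edges -/
def chi (μ : Finset (Sym2 V)) : Sym2 V → ℝ := fun e => if e ∈ μ then 1 else 0

open Classical in
/-- `E_x = {e ∈ E : x(e) > 0}` -/
noncomputable def supp (x : Sym2 V → ℝ) : Finset (Sym2 V) :=
  S.E.filter (fun e => 0 < x e)

/-- `V₁` : the set of vertices `v` with `x(E(v)) > 0` for some `x ∈ P` -/
def V1 : Set V := {v : V | ∃ x : Sym2 V → ℝ, S.memP x ∧ 0 < xS x (inc S.E v)}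

open Classical in
/-- `B_x(v)` : the best edges in `E_x(v)` for `v` -/
noncomputable def Bset (x : Sym2 V → ℝ) (v : V) : Finset (Sym2 V) :=
  (inc (S.supp x) v).filter
    (fun e => ∀ f ∈ inc (S.supp x) v, S.pref v (some e) (some f))

open Classical in
/-- `W_x(v)` : the worst edges in `E_x(v)` for `v` -/
noncomputable def Wset (x : Sym2 V → ℝ) (v : V) : Finset (Sym2 V) :=
  (inc (S.supp x) v).filter
    (fun e => ∀ f ∈ inc (S.supp x) v, S.pref v (some f) (some e))

/-- a nonempty `F ⊆ E(v)` is flat if `v` is indifferent among its members -/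
def Flat (v : V) (F : Finset (Sym2 V)) : Prop :=
  F.Nonempty ∧ ∀ e ∈ F, ∀ f ∈ F, S.IPref v (some e) (some f)

open Classical in
/-- `T_x` : edges `e ∈ E⟨V₁⟩` such that, for each `v ∈ e`, either
`e ∈ B_x(v) ∪ W_x(v)` or `B_x(v) ≻ᵥ e ≻ᵥ W_x(v)`. -/
noncomputable def Tset (x : Sym2 V → ℝ) : Finset (Sym2 V) :=
  (S.E.filter (fun e => ∀ u ∈ e, u ∈ S.V1)).filter (fun e => ∀ v ∈ e,
    (e ∈ S.Bset x v ∪ S.Wset x v) ∨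
      ((∀ f ∈ S.Bset x v, S.SPref v (some f) (some e)) ∧
        (∀ f ∈ S.Wset x v, S.SPref v (some e) (some f))))

/-- membership in `P(F) = {x ∈ P : x(e) = 0 for all e ∈ E \ F}` -/
def memPF (F : Finset (Sym2 V)) (x : Sym2 V → ℝ) : Prop :=
  S.memP x ∧ ∀ e ∈ S.E, e ∉ F → x e = 0

open Classical in
/-- `E⁺ = {e ∈ E : e ∈ E_z for some z ∈ P}` -/
noncomputable def Eplus : Finset (Sym2 V) :=
  S.E.filter (fun e => ∃ z : Sym2 V → ℝ, S.memP z ∧ 0 < z e)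

open Classical in
/-- `P'` : given `x ∈ P` and a strongly stable matching `σ`, the set of
vertices `v ∈ V₁` with `W_x(v) ≻ᵥ σ(v)`, or with
`B_x(v) ≻ᵥ W_x(v)` and `W_x(v) ∼ᵥ σ(v)`. -/
def Pset (x : Sym2 V → ℝ) (σ : Finset (Sym2 V)) : Set V :=
  {v : V | v ∈ S.V1 ∧
    ((∀ f ∈ S.Wset x v, S.SPref v (some f) (matchOf σ v)) ∨
      ((∀ f ∈ S.Bset x v, ∀ g ∈ S.Wset x v, S.SPref v (some f) (some g)) ∧
        (∀ f ∈ S.Wset x v, S.IPref v (some f) (matchOf σ v))))}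

/-- `Q'` : given `x ∈ P` and a strongly stable matching `σ`, the set of
vertices `v ∈ V₁` with `σ(v) ≻ᵥ B_x(v)`, or with
`B_x(v) ≻ᵥ W_x(v)` and `B_x(v) ∼ᵥ σ(v)`. -/
def Qset (x : Sym2 V → ℝ) (σ : Finset (Sym2 V)) : Set V :=
  {v : V | v ∈ S.V1 ∧
    ((∀ f ∈ S.Bset x v, S.SPref v (matchOf σ v) (some f)) ∨
      ((∀ f ∈ S.Bset x v, ∀ g ∈ S.Wset x v, S.SPref v (some f) (some g)) ∧
        (∀ f ∈ S.Bset x v, S.IPref v (some f) (matchOf σ v))))}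

/-- `R'` : given `x ∈ P` and a strongly stable matching `σ`, the set of
vertices `v ∈ V₁` such that `E_x(v)` is flat and `E_x(v) ∼ᵥ σ(v)`. -/
def Rset (x : Sym2 V → ℝ) (σ : Finset (Sym2 V)) : Set V :=
  {v : V | v ∈ S.V1 ∧ S.Flat v (inc (S.supp x) v) ∧
    ∀ f ∈ inc (S.supp x) v, S.IPref v (some f) (matchOf σ v)}

end RSetup
namespace RSetup

lemma matchOf_eq_some {V : Type*} [DecidableEq V] {μ : Finset (Sym2 V)} {v : V} {f : Sym2 V}
    (hμ : (inc μ v).card ≤ 1) (hf : f ∈ inc μ v) : matchOf μ v = some f := by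
  have h : inc μ v = {f} :=
    Finset.eq_singleton_iff_unique_mem.2 ⟨hf, fun g hg => Finset.card_le_one.1 hμ g hg f hf⟩
  simp [matchOf, h]

lemma exists_mem_eq_one_of_xS_pos {V : Type*} {x : Sym2 V → ℝ}
    (h01 : ∀ e, x e = 0 ∨ x e = 1) {W : Finset (Sym2 V)} (h : 0 < xS x W) : ∃ f ∈ W, x f = 1 := by
  by_contra! hne
  exact h.ne' (Finset.sum_eq_zero fun f hf => (h01 f).resolve_right (hne f hf))

end RSetup

open RSetup Classical in
/-- If `x ∈ P` is a 0/1 vector, then `μ = {e ∈ E : x(e) = 1}`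
is a strongly stable matching in `G`. -/
theorem stronglyStable_of_integral_mem_P
    {V : Type*} [Fintype V] [DecidableEq V] (S : RSetup V)
    (x : Sym2 V → ℝ) (hx : S.memP x) (h01 : ∀ e, x e = 0 ∨ x e = 1) :
    S.StronglyStable (S.E.filter (fun e => x e = 1)) := by
  have hmem (v : V) (f : Sym2 V) (hf : f ∈ inc S.E v) (hxf : x f = 1) :
      f ∈ inc (S.E.filter (fun e => x e = 1)) v := by
    simp only [inc, Finset.mem_filter] at hf ⊢
    exact ⟨⟨hf.1, hxf⟩, hf.2⟩
  obtain ⟨⟨hnonneg, -⟩, hdeg, hstab, -⟩ := hx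
  have hcard (v : V) : (inc (S.E.filter (fun e => x e = 1)) v).card ≤ 1 := by
    have hsub : inc (S.E.filter (fun e => x e = 1)) v ⊆ inc S.E v :=
      Finset.filter_subset_filter _ (Finset.filter_subset _ _)
    have hsum : xS x (inc (S.E.filter (fun e => x e = 1)) v)
        = (inc (S.E.filter (fun e => x e = 1)) v).card := by
      rw [xS, Finset.sum_congr rfl (g := fun _ => (1 : ℝ))]
      · simp
      · intro e he
        exact (Finset.mem_filter.1 (Finset.mem_filter.1 he).1).2
    have hle : xS x (inc (S.E.filter (fun e => x e = 1)) v) ≤ xS x (inc S.E v) :=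
      Finset.sum_le_sum_of_subset_of_nonneg hsub fun e _ _ => hnonneg e
    exact_mod_cast hsum ▸ hle.trans (hdeg v)
  refine ⟨⟨Finset.filter_subset _ _, hcard⟩, ?_⟩
  rintro e ⟨heE, -, hweak, v, hve, hstrict⟩
  obtain ⟨w, rfl⟩ := hve
  have hmatch (u : V) (f : Sym2 V) (hf : f ∈ inc S.E u) (hxf : x f = 1) :=
    matchOf_eq_some (hcard u) (hmem u f hf hxf)
  have hzero {W : Finset (Sym2 V)} (hW : ∀ f ∈ W, x f ≠ 1) : xS x W ≤ 0 := by
    by_contra! hpos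
    obtain ⟨f, hf, hxf⟩ := exists_mem_eq_one_of_xS_pos h01 hpos
    exact hW f hf hxf
  have hsim : xS x (S.simSet v s(v, w)) ≤ 0 := hzero fun f hf hxf => by
    obtain ⟨hfE, hpref⟩ := Finset.mem_filter.1 hf
    exact hstrict.2 (hmatch v f hfE hxf ▸ hpref.1)
  have hsucc (u : V) (hu : u ∈ s(v, w)) : xS x (S.succSet u s(v, w)) ≤ 0 :=
    hzero fun f hf hxf => by
      obtain ⟨hfE, hpref⟩ := Finset.mem_filter.1 hf
      exact hpref.2 (hmatch u f hfE hxf ▸ hweak u hu)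
  linarith [hstab v w heE, hsucc v (Sym2.mem_mk_left v w), hsucc w (Sym2.mem_mk_right v w)]
end

section
/- Let G=(V,E) be a finite simple undirected graph with preferences as described. Let x,z∈ℝ₊^E both satisfy constraints (1) and (2), and let e={v,w} be an edge with z(e)>0. Then: (S1) x(E(u))=1 for every vertex u∈e; (S2) x(E[∼_u e]) + Σ_{u'∈e} x(E[≻_{u'} e]) = 1 for every vertex u∈e; and (S3) x(E[∼_v e]) = x(E[∼_w e]). -/
namespace RSetup

variable {V : Type*} [Fintype V] [DecidableEq V] (S : RSetup V)

/-- `x(E[∼ᵥ e]) + 2 x(E[≻ᵥ e])`: the contribution of the vertex `v` to the sum of the two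
constraints (2) of the edge `e`. -/
noncomputable def weight (x : Sym2 V → ℝ) (v : V) (e : Sym2 V) : ℝ :=
  xS x (S.simSet v e) + 2 * xS x (S.succSet v e)

open Classical in
/-- The coefficient of `x f` in `S.weight x v e`. -/
noncomputable def coeff (v : V) (f e : Sym2 V) : ℝ :=
  (if S.IPref v (some f) (some e) then 1 else 0) +
    2 * (if S.SPref v (some f) (some e) then 1 else 0)

lemma weight_eq_sum_coeff (x : Sym2 V → ℝ) (v : V) (e : Sym2 V) :
    S.weight x v e = ∑ f ∈ inc S.E v, x f * S.coeff v f e := by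
  simp only [weight, xS, simSet, succSet, coeff, Finset.sum_filter, Finset.mul_sum,
    ← Finset.sum_add_distrib]
  refine Finset.sum_congr rfl fun f _ => ?_
  split_ifs <;> ring

lemma coeff_add_coeff {v : V} {e f : Sym2 V} (he : e ∈ inc S.E v) (hf : f ∈ inc S.E v) :
    S.coeff v f e + S.coeff v e f = 2 := by
  simp only [inc, Finset.mem_filter] at he hf
  have h := S.pref_total v (some e) (some f) (by rintro _ ⟨⟩; exact he) (by rintro _ ⟨⟩; exact hf)
  by_cases h₁ : S.pref v (some e) (some f) <;> by_cases h₂ : S.pref v (some f) (some e) <;>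
    simp_all [coeff, IPref, SPref]
  norm_num

lemma sum_weight_add_sum_weight (x z : Sym2 V → ℝ) (v : V) :
    ∑ e ∈ inc S.E v, z e * S.weight x v e + ∑ e ∈ inc S.E v, x e * S.weight z v e =
      2 * (xS z (inc S.E v) * xS x (inc S.E v)) := by
  rw [xS, xS, Finset.sum_mul_sum]
  simp only [weight_eq_sum_coeff, Finset.mul_sum]
  rw [Finset.sum_comm (f := fun e f : Sym2 V => x e * (z f * S.coeff v f e)),
    ← Finset.sum_add_distrib]
  refine Finset.sum_congr rfl fun e he => ?_
  rw [← Finset.sum_add_distrib]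
  refine Finset.sum_congr rfl fun f hf => ?_
  linear_combination z e * x f * S.coeff_add_coeff he hf

lemma sum_edges_eq_sum_vertices (F : V → Sym2 V → ℝ) :
    ∑ e ∈ S.E, ∑ u with u ∈ e, F u e = ∑ u, ∑ e ∈ inc S.E u, F u e :=
  Finset.sum_comm' (by simp [inc])

lemma sum_endpoints {v w : V} (he : s(v, w) ∈ S.E) (F : V → ℝ) :
    ∑ u with u ∈ s(v, w), F u = F v + F w := by
  have hvw : v ≠ w := by simpa using S.not_diag _ he
  rw [show (Finset.univ.filter fun u => u ∈ s(v, w)) = {v, w} by ext; simp,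
    Finset.sum_pair hvw]

variable {S}

lemma C2.symm {x : Sym2 V → ℝ} (hx : S.C2 x) {v w : V} (he : s(v, w) ∈ S.E) :
    xS x (S.simSet w s(v, w)) +
      (xS x (S.succSet v s(v, w)) + xS x (S.succSet w s(v, w))) ≥ 1 := by
  have h := hx w v (Sym2.eq_swap ▸ he)
  rw [Sym2.eq_swap] at h
  linarith

lemma C2.slack_nonneg {x : Sym2 V → ℝ} (hx : S.C2 x) {e : Sym2 V} (he : e ∈ S.E) :
    0 ≤ ∑ u with u ∈ e, (S.weight x u e - 1) := by
  induction e with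
  | _ v w =>
    have h₁ := hx v w he
    have h₂ := hx.symm he
    rw [S.sum_endpoints he]
    simp only [weight]
    linarith

lemma xS_nonneg {x : Sym2 V → ℝ} (hx : S.IsVec x) (W : Finset (Sym2 V)) : 0 ≤ xS x W :=
  Finset.sum_nonneg fun e _ => hx.1 e

variable (S) in
lemma sum_slack (x z : Sym2 V → ℝ) :
    ∑ e ∈ S.E, z e * ∑ u with u ∈ e, (S.weight x u e - 1) +
        ∑ e ∈ S.E, x e * ∑ u with u ∈ e, (S.weight z u e - 1) =
      -∑ u, (xS z (inc S.E u) * (1 - xS x (inc S.E u)) +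
        xS x (inc S.E u) * (1 - xS z (inc S.E u))) := by
  simp only [Finset.mul_sum]
  rw [sum_edges_eq_sum_vertices, sum_edges_eq_sum_vertices, ← Finset.sum_add_distrib,
    ← Finset.sum_neg_distrib]
  refine Finset.sum_congr rfl fun u _ => ?_
  have h := S.sum_weight_add_sum_weight x z u
  simp only [mul_sub, mul_one, Finset.sum_sub_distrib]
  simp only [xS] at h ⊢
  linear_combination h

end RSetup

open RSetup in
/-- self-duality consequences (S1), (S2), (S3): if `x, z ≥ 0`
satisfy constraints (1) and (2) and `e = {v, w}` is an edge with `z(e) > 0`,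
then `x(E(u)) = 1` for each `u ∈ e`,
`x(E[∼ᵤ e]) + ∑_{u' ∈ e} x(E[≻_{u'} e]) = 1` for each `u ∈ e`, and
`x(E[∼ᵥ e]) = x(E[∼_w e])`. -/
theorem self_dual_slackness
    {V : Type*} [Fintype V] [DecidableEq V] (S : RSetup V)
    (x z : Sym2 V → ℝ)
    (hx : S.IsVec x ∧ S.C1 x ∧ S.C2 x) (hz : S.IsVec z ∧ S.C1 z ∧ S.C2 z)
    (v w : V) (he : s(v, w) ∈ S.E) (hze : 0 < z s(v, w)) :
    (∀ u ∈ s(v, w), xS x (inc S.E u) = 1) ∧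
    (∀ u ∈ s(v, w),
      xS x (S.simSet u s(v, w)) +
        (xS x (S.succSet v s(v, w)) + xS x (S.succSet w s(v, w))) = 1) ∧
    xS x (S.simSet v s(v, w)) = xS x (S.simSet w s(v, w)) := by
  obtain ⟨hx₀, hx₁, hx₂⟩ := hx
  obtain ⟨hz₀, hz₁, hz₂⟩ := hz
  have hzx : ∀ e ∈ S.E, 0 ≤ z e * ∑ u with u ∈ e, (S.weight x u e - 1) :=
    fun e he => mul_nonneg (hz₀.1 e) (hx₂.slack_nonneg he)
  have hxz : ∀ e ∈ S.E, 0 ≤ x e * ∑ u with u ∈ e, (S.weight z u e - 1) :=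
    fun e he => mul_nonneg (hx₀.1 e) (hz₂.slack_nonneg he)
  have hleft : ∀ u, 0 ≤ xS z (inc S.E u) * (1 - xS x (inc S.E u)) :=
    fun u => mul_nonneg (xS_nonneg hz₀ _) (sub_nonneg.2 (hx₁ u))
  have hright : ∀ u, 0 ≤ xS x (inc S.E u) * (1 - xS z (inc S.E u)) :=
    fun u => mul_nonneg (xS_nonneg hx₀ _) (sub_nonneg.2 (hz₁ u))
  have hvert : ∀ u ∈ Finset.univ, 0 ≤ xS z (inc S.E u) * (1 - xS x (inc S.E u)) +
      xS x (inc S.E u) * (1 - xS z (inc S.E u)) :=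
    fun u _ => add_nonneg (hleft u) (hright u)
  have hsum := S.sum_slack x z
  have hsum_zx := Finset.sum_nonneg hzx
  have hsum_xz := Finset.sum_nonneg hxz
  have hsum_vert := Finset.sum_nonneg hvert
  have hedge := (Finset.sum_eq_zero_iff_of_nonneg hzx).1 (by linarith) _ he
  have htight := (mul_eq_zero.1 hedge).resolve_left hze.ne'
  rw [S.sum_endpoints he] at htight
  simp only [weight] at htight
  have h₁ := hx₂ v w he
  have h₂ := hx₂.symm he
  refine ⟨fun u hu => ?_, fun u hu => ?_, by linarith⟩
  · have hzero := (Finset.sum_eq_zero_iff_of_nonneg hvert).1 (by linarith) u (Finset.mem_univ u)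
    have hpos : 0 < xS z (inc S.E u) :=
      hze.trans_le (Finset.single_le_sum (f := z) (fun e _ => hz₀.1 e)
        (Finset.mem_filter.2 ⟨he, hu⟩))
    have hprod : xS z (inc S.E u) * (1 - xS x (inc S.E u)) = 0 := by
      linarith [hleft u, hright u]
    linarith [(mul_eq_zero.1 hprod).resolve_left hpos.ne']
  · rcases Sym2.mem_iff.1 hu with rfl | rfl <;> linarith
end

section
/- Let G=(V,E) be a finite simple undirected graph with preferences as described, and assume P≠∅. Let v be a vertex such that z(E(v))>0 for some z∈P (i.e., v∈V₁). Then x(E(v)) = 1 for every x∈P. -/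
namespace RSetup

variable {V : Type*} [Fintype V] [DecidableEq V] (S : RSetup V)

open Classical in
/-- The comparison weight of `f` against `e` at `v`: `2` if `f ≻ᵥ e`, `1` if `f ∼ᵥ e`,
`0` otherwise. -/
noncomputable def prefWeight (v : V) (f e : Sym2 V) : ℝ :=
  2 * (if S.SPref v (some f) (some e) then 1 else 0) +
    (if S.IPref v (some f) (some e) then 1 else 0)

lemma prefWeight_add_swap {v : V} {e f : Sym2 V} (he : e ∈ inc S.E v) (hf : f ∈ inc S.E v) :
    S.prefWeight v f e + S.prefWeight v e f = 2 := by
  simp only [inc, Finset.mem_filter] at he hf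
  have htotal := S.pref_total v (some e) (some f)
    (by rintro _ ⟨⟩; exact he) (by rintro _ ⟨⟩; exact hf)
  unfold prefWeight SPref IPref
  by_cases hef : S.pref v (some e) (some f) <;> by_cases hfe : S.pref v (some f) (some e)
  · norm_num [hef, hfe]
  · norm_num [hef, hfe]
  · norm_num [hef, hfe]
  · exact (htotal.elim hef hfe).elim

lemma sum_mul_prefWeight (x : Sym2 V → ℝ) (v : V) (e : Sym2 V) :
    ∑ f ∈ inc S.E v, x f * S.prefWeight v f e =
      2 * xS x (S.succSet v e) + xS x (S.simSet v e) := by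
  unfold xS succSet simSet prefWeight
  rw [Finset.sum_filter, Finset.sum_filter, Finset.mul_sum, ← Finset.sum_add_distrib]
  refine Finset.sum_congr rfl fun f _ => ?_
  split_ifs <;> ring

/-- Averaging constraint (2) for `x` against a nonnegative vector `z`. -/
lemma sum_mul_sum_prefWeight_sub_one_nonneg {x z : Sym2 V → ℝ} (hz : ∀ e, 0 ≤ z e)
    (hx : S.C2 x) :
    0 ≤ ∑ v, ∑ e ∈ inc S.E v, z e * ((∑ f ∈ inc S.E v, x f * S.prefWeight v f e) - 1) := by
  simp_rw [sum_mul_prefWeight, inc, Finset.sum_filter]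
  rw [Finset.sum_comm]
  refine Finset.sum_nonneg fun e he => ?_
  rw [← Finset.sum_filter]
  induction e with | _ a b =>
  have hab : a ≠ b := fun h => S.not_diag _ he (Sym2.mk_isDiag_iff.2 h)
  have hends : Finset.univ.filter (fun v => v ∈ s(a, b)) = {a, b} := by
    ext v; simp
  rw [hends, Finset.sum_pair hab, ← mul_add]
  refine mul_nonneg (hz _) ?_
  have h₁ := hx a b he
  have h₂ := hx b a (by rwa [Sym2.eq_swap])
  rw [Sym2.eq_swap (a := b) (b := a)] at h₂
  linarith

lemma sum_mul_prefWeight_add_swap (x z : Sym2 V → ℝ) (v : V) :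
    ∑ e ∈ inc S.E v, z e * ((∑ f ∈ inc S.E v, x f * S.prefWeight v f e) - 1) +
      ∑ e ∈ inc S.E v, x e * ((∑ f ∈ inc S.E v, z f * S.prefWeight v f e) - 1) =
    2 * xS x (inc S.E v) * xS z (inc S.E v) - xS x (inc S.E v) - xS z (inc S.E v) := by
  have hswap : ∑ e ∈ inc S.E v, ∑ f ∈ inc S.E v, z e * (x f * S.prefWeight v f e) +
      ∑ e ∈ inc S.E v, ∑ f ∈ inc S.E v, x e * (z f * S.prefWeight v f e) =
      2 * (xS z (inc S.E v) * xS x (inc S.E v)) := by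
    rw [Finset.sum_comm (f := fun e f => x e * (z f * S.prefWeight v f e)), xS, xS,
      Finset.sum_mul_sum, Finset.mul_sum, ← Finset.sum_add_distrib]
    refine Finset.sum_congr rfl fun e he => ?_
    rw [Finset.mul_sum, ← Finset.sum_add_distrib]
    refine Finset.sum_congr rfl fun f hf => ?_
    linear_combination z e * x f * S.prefWeight_add_swap he hf
  simp only [mul_sub, mul_one, Finset.sum_sub_distrib, Finset.mul_sum]
  unfold xS at hswap ⊢
  linear_combination hswap

end RSetup

open RSetup in
/-- if `P ≠ ∅` and `v ∈ V₁` (i.e. `z(E(v)) > 0` for some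
`z ∈ P`), then `x(E(v)) = 1` for every `x ∈ P`. -/
theorem xS_inc_eq_one_of_mem_V1
    {V : Type*} [Fintype V] [DecidableEq V] (S : RSetup V)
    (hP : ∃ y : Sym2 V → ℝ, S.memP y)
    (v : V) (hv : v ∈ S.V1)
    (x : Sym2 V → ℝ) (hx : S.memP x) :
    xS x (inc S.E v) = 1 := by
  obtain ⟨z, hz, hzv⟩ := hv
  obtain ⟨⟨hx₀, -⟩, hx₁, hx₂, -⟩ := hx
  obtain ⟨⟨hz₀, -⟩, hz₁, hz₂, -⟩ := hz
  have hsum : 0 ≤ ∑ u, (2 * xS x (inc S.E u) * xS z (inc S.E u) -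
      xS x (inc S.E u) - xS z (inc S.E u)) := by
    simp_rw [← sum_mul_prefWeight_add_swap, Finset.sum_add_distrib]
    exact add_nonneg (S.sum_mul_sum_prefWeight_sub_one_nonneg hz₀ hx₂)
      (S.sum_mul_sum_prefWeight_sub_one_nonneg hx₀ hz₂)
  have hterm : ∀ u ∈ Finset.univ, 2 * xS x (inc S.E u) * xS z (inc S.E u) -
      xS x (inc S.E u) - xS z (inc S.E u) ≤ 0 := fun u _ => by
    have hxu : 0 ≤ xS x (inc S.E u) := Finset.sum_nonneg fun e _ => hx₀ e
    have hzu : 0 ≤ xS z (inc S.E u) := Finset.sum_nonneg fun e _ => hz₀ e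
    nlinarith [hx₁ u, hz₁ u]
  have hzero := (Finset.sum_eq_zero_iff_of_nonpos hterm).1
    (le_antisymm (Finset.sum_nonpos hterm) hsum) v (Finset.mem_univ v)
  have hxv : 0 ≤ xS x (inc S.E v) := Finset.sum_nonneg fun e _ => hx₀ e
  refine le_antisymm (hx₁ v) ?_
  nlinarith [hx₁ v, hz₁ v, mul_nonneg hxv (sub_nonneg.2 (hz₁ v))]
end

section
/- Let G=(V,E) be a finite simple undirected graph with preferences as described, and assume P≠∅. Let x∈P, and assume that there exists a strongly stable matching in G. Then there exists a strongly stable matching μ in G such that χ_μ ∈ P(T_x), i.e., χ_μ∈P and μ⊆T_x. -/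
section StronglyStableMates

open Finset

theorem exists_involution_of_fractional_perfect_matching {A : Type*} [Fintype A]
    (y : A → A → ℝ) (nonneg : ∀ a b, 0 ≤ y a b) (symm : ∀ a b, y a b = y b a)
    (irrefl : ∀ a, y a a = 0) (row : ∀ a, ∑ b, y a b = 1)
    (odd : ∀ X : Finset A, Odd X.card → ∑ a ∈ X, ∑ b ∈ X, y a b ≤ X.card - 1) :
    ∃ m : A → A, Function.Involutive m ∧ ∀ a, 0 < y a (m a) := by
  classical
  let H : SimpleGraph A :=
    { Adj := fun a b => 0 < y a b
      symm := ⟨fun a b h => by rwa [symm] at h⟩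
      loopless := ⟨fun a h => by simp [irrefl] at h⟩ }
  obtain ⟨M, hM⟩ : ∃ M : H.Subgraph, M.IsPerfectMatching := by
    rw [SimpleGraph.tutte]
    intro U hU
    unfold SimpleGraph.IsTutteViolator at hU
    set K := ((⊤ : H.Subgraph).deleteVerts U).coe with hK
    let O : Finset K.ConnectedComponent := K.oddComponents.toFinset
    have hO : K.oddComponents.ncard = O.card := Set.ncard_eq_toFinset_card' _
    have hUc : U.ncard = U.toFinset.card := Set.ncard_eq_toFinset_card' _
    let X : K.ConnectedComponent → Finset A := fun c =>
      c.supp.toFinset.map (Function.Embedding.subtype _)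
    have memX : ∀ c a, a ∈ X c ↔ ∃ h, K.connectedComponentMk ⟨a, h⟩ = c := by
      intro c a
      simp [X]
    have cut : ∀ c ∈ O, 1 ≤ ∑ a ∈ X c, ∑ b ∈ U.toFinset, y a b := by
      intro c hc
      have hodd : Odd (X c).card := by
        have : Odd c.supp.ncard := by simpa [O] using hc
        rwa [Set.ncard_eq_toFinset_card', ← Finset.card_map (Function.Embedding.subtype _)] at this
      have h1 := odd _ hodd
      have h2 : ∑ a ∈ X c, (∑ b ∈ X c, y a b + ∑ b ∈ U.toFinset, y a b) = (X c).card := by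
        rw [Finset.card_eq_sum_ones, Nat.cast_sum]
        refine Finset.sum_congr rfl fun a ha => ?_
        rw [Nat.cast_one, ← row a, ← Finset.sum_union]
        · refine Finset.sum_subset (Finset.subset_univ _) fun b _ hb => ?_
          by_contra hne
          have hpos : 0 < y a b := lt_of_le_of_ne (nonneg _ _) (Ne.symm hne)
          simp only [Finset.mem_union, Set.mem_toFinset, not_or] at hb
          obtain ⟨haU, hac⟩ := (memX c a).1 ha
          refine hb.1 ((memX c b).2 ⟨by simpa using hb.2, ?_⟩)
          refine Eq.trans ?_ hac
          refine SimpleGraph.ConnectedComponent.sound (SimpleGraph.Adj.reachable ?_)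
          have haU' : a ∉ U := by simpa using haU
          simp [hK, H, haU', hb.2, symm b a, hpos]
        · rw [Finset.disjoint_left]
          intro b hb hbU
          obtain ⟨h, -⟩ := (memX c b).1 hb
          simp at h hbU
          exact h hbU
      rw [Finset.sum_add_distrib] at h2
      linarith
    have h3 : (O.card : ℝ) ≤ U.toFinset.card := by
      calc (O.card : ℝ) = ∑ c ∈ O, (1 : ℝ) := by simp
        _ ≤ ∑ c ∈ O, ∑ a ∈ X c, ∑ b ∈ U.toFinset, y a b := Finset.sum_le_sum cut
        _ = ∑ a ∈ O.biUnion X, ∑ b ∈ U.toFinset, y a b := by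
            rw [Finset.sum_biUnion]
            intro c _ d _ hcd
            rw [Function.onFun, Finset.disjoint_left]
            intro a hac had
            obtain ⟨_, h⟩ := (memX c a).1 hac
            obtain ⟨_, h'⟩ := (memX d a).1 had
            exact hcd (h.symm.trans h')
        _ ≤ ∑ a, ∑ b ∈ U.toFinset, y a b :=
            Finset.sum_le_sum_of_subset_of_nonneg (Finset.subset_univ _)
              fun a _ _ => Finset.sum_nonneg fun b _ => nonneg a b
        _ = ∑ b ∈ U.toFinset, ∑ a, y b a := by
            rw [Finset.sum_comm]
            simp only [symm]
        _ = U.toFinset.card := by simp [row]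
    rw [hO, hUc] at hU
    exact absurd (Nat.cast_le.1 h3) (not_le.2 hU)
  rw [SimpleGraph.Subgraph.isPerfectMatching_iff] at hM
  choose m hm hm' using hM
  exact ⟨m, fun a => (hm' _ _ (M.symm.symm _ _ (hm a))).symm, fun a => M.adj_sub (hm a)⟩

section Fractional

variable {V : Type*} [Fintype V]

/-- The `x`-weight at `a` of the partners that `a` ranks at least as high as `b`. -/
def upperWeight (u : V → V → ℕ) (x : V → V → ℝ) (a b : V) : ℝ :=
  ∑ c, if u a b ≤ u a c then x a c else 0

/-- The `x`-weight at `a` of the partners that `a` ranks strictly higher than `b`. -/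
def strictUpperWeight (u : V → V → ℕ) (x : V → V → ℝ) (a b : V) : ℝ :=
  ∑ c, if u a b < u a c then x a c else 0

/-- The degree and stability inequalities for a symmetric weight function `x`, where vertex `a`
ranks its neighbours by the utility `u a`, which is positive exactly on neighbours. -/
structure IsFractionalStable (u : V → V → ℕ) (x : V → V → ℝ) : Prop where
  nonneg : ∀ a b, 0 ≤ x a b
  symm : ∀ a b, x a b = x b a
  pos_utility : ∀ a b, 0 < x a b → 0 < u a b
  degree_le : ∀ a, ∑ b, x a b ≤ 1
  stable : ∀ a b, 0 < u a b → 1 ≤ upperWeight u x a b + strictUpperWeight u x b a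

/-- Stability of the matching in which `a` is matched to `m a`, or unmatched if `m a = a`. -/
def IsStableMate (u : V → V → ℕ) (m : V → V) : Prop :=
  ∀ a b, 0 < u a b → u a b < u a (m a) ∨ u b a ≤ u b (m b)

variable {u : V → V → ℕ} {x y : V → V → ℝ}

theorem sum_mul_strictUpperWeight_swap (hy : ∀ a b, y a b = y b a) :
    ∑ a, ∑ b, y a b * strictUpperWeight u x b a =
      ∑ a, ∑ b, y a b * strictUpperWeight u x a b := by
  rw [Finset.sum_comm]
  simp only [hy]

theorem sum_mul_weights_add (u : V → V → ℕ) (x y : V → V → ℝ) (a : V) :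
    ∑ b, y a b * (upperWeight u x a b + strictUpperWeight u x a b) +
      ∑ b, x a b * (upperWeight u y a b + strictUpperWeight u y a b) =
      2 * (∑ b, x a b) * ∑ b, y a b := by
  have h : ∀ x y : V → V → ℝ,
      ∑ b, y a b * (upperWeight u x a b + strictUpperWeight u x a b) =
        ∑ b, ∑ c, y a b * x a c *
          ((if u a b ≤ u a c then 1 else 0) + if u a b < u a c then 1 else 0) := by
    intro x y
    refine Finset.sum_congr rfl fun b _ => ?_
    rw [upperWeight, strictUpperWeight, ← Finset.sum_add_distrib, Finset.mul_sum]
    refine Finset.sum_congr rfl fun c _ => ?_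
    split_ifs <;> ring
  rw [h x y, h y x, mul_assoc, Finset.sum_mul_sum, Finset.mul_sum, Finset.sum_comm,
    ← Finset.sum_add_distrib]
  refine Finset.sum_congr rfl fun b _ => ?_
  rw [← Finset.sum_add_distrib, Finset.mul_sum]
  refine Finset.sum_congr rfl fun c _ => ?_
  rcases lt_trichotomy (u a b) (u a c) with h | h | h
  · simp [h, h.le, h.not_ge, h.not_gt]; ring
  · simp [h]; ring
  · simp [h, h.le, h.not_ge, h.not_gt]; ring

theorem IsFractionalStable.slack_nonneg (hx : IsFractionalStable u x)
    (hy : IsFractionalStable u y) (a b : V) :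
    0 ≤ y a b * (upperWeight u x a b + strictUpperWeight u x b a - 1) := by
  rcases (hy.nonneg a b).eq_or_lt with h | h
  · simp [← h]
  · exact mul_nonneg h.le (sub_nonneg.2 (hx.stable a b (hy.pos_utility a b h)))

theorem IsFractionalStable.degree_slack_nonneg (hx : IsFractionalStable u x)
    (hy : IsFractionalStable u y) (a : V) :
    0 ≤ (∑ b, x a b) * (1 - ∑ b, y a b) + (∑ b, y a b) * (1 - ∑ b, x a b) :=
  add_nonneg
    (mul_nonneg (Finset.sum_nonneg fun b _ => hx.nonneg a b) (sub_nonneg.2 (hy.degree_le a)))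
    (mul_nonneg (Finset.sum_nonneg fun b _ => hy.nonneg a b) (sub_nonneg.2 (hx.degree_le a)))

theorem IsFractionalStable.sum_slack_eq_zero (hx : IsFractionalStable u x)
    (hy : IsFractionalStable u y) :
    ∑ a, ∑ b, y a b * (upperWeight u x a b + strictUpperWeight u x b a - 1) +
      ∑ a, ∑ b, x a b * (upperWeight u y a b + strictUpperWeight u y b a - 1) +
      ∑ a, ((∑ b, x a b) * (1 - ∑ b, y a b) + (∑ b, y a b) * (1 - ∑ b, x a b)) = 0 := by
  have h : ∀ {x y : V → V → ℝ}, IsFractionalStable u y →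
      ∑ a, ∑ b, y a b * (upperWeight u x a b + strictUpperWeight u x b a - 1) =
        ∑ a, (∑ b, y a b * (upperWeight u x a b + strictUpperWeight u x a b) -
          ∑ b, y a b) := by
    intro x y hy
    simp only [mul_sub, mul_add, Finset.sum_sub_distrib, Finset.sum_add_distrib, mul_one,
      sum_mul_strictUpperWeight_swap hy.symm]
  rw [h hy, h hx, ← Finset.sum_add_distrib, ← Finset.sum_add_distrib]
  refine Finset.sum_eq_zero fun a _ => ?_
  linear_combination sum_mul_weights_add u x y a

theorem IsFractionalStable.tight (hx : IsFractionalStable u x) (hy : IsFractionalStable u y)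
    {a b : V} (h : 0 < y a b) : upperWeight u x a b + strictUpperWeight u x b a = 1 := by
  have h0 := hx.sum_slack_eq_zero hy
  have h1 : ∀ a, 0 ≤ ∑ b, y a b * (upperWeight u x a b + strictUpperWeight u x b a - 1) :=
    fun a => Finset.sum_nonneg fun b _ => hx.slack_nonneg hy a b
  have h2 : 0 ≤ ∑ a, ∑ b, x a b * (upperWeight u y a b + strictUpperWeight u y b a - 1) :=
    Finset.sum_nonneg fun a _ => Finset.sum_nonneg fun b _ => hy.slack_nonneg hx a b
  have h3 := Finset.sum_nonneg fun a (_ : a ∈ univ) => hx.degree_slack_nonneg hy a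
  have h4 := Finset.single_le_sum (fun a _ => h1 a) (Finset.mem_univ a)
  have h5 := Finset.single_le_sum (fun b _ => hx.slack_nonneg hy a b) (Finset.mem_univ b)
  have h6 : y a b * (upperWeight u x a b + strictUpperWeight u x b a - 1) = 0 :=
    le_antisymm (by linarith) (hx.slack_nonneg hy a b)
  have := (mul_eq_zero.1 h6).resolve_left h.ne'
  linarith

theorem IsFractionalStable.degree_tight (hx : IsFractionalStable u x)
    (hy : IsFractionalStable u y) (a : V) :
    (∑ b, x a b) * (1 - ∑ b, y a b) + (∑ b, y a b) * (1 - ∑ b, x a b) = 0 := by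
  have h0 := hx.sum_slack_eq_zero hy
  have h1 : 0 ≤ ∑ a, ∑ b, y a b * (upperWeight u x a b + strictUpperWeight u x b a - 1) :=
    Finset.sum_nonneg fun a _ => Finset.sum_nonneg fun b _ => hx.slack_nonneg hy a b
  have h2 : 0 ≤ ∑ a, ∑ b, x a b * (upperWeight u y a b + strictUpperWeight u y b a - 1) :=
    Finset.sum_nonneg fun a _ => Finset.sum_nonneg fun b _ => hy.slack_nonneg hx a b
  have h4 := Finset.single_le_sum (fun a _ => hx.degree_slack_nonneg hy a) (Finset.mem_univ a)
  exact le_antisymm (by linarith) (hx.degree_slack_nonneg hy a)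

theorem IsFractionalStable.strictUpperWeight_eq_zero_iff (hx : IsFractionalStable u x)
    {a b : V} : strictUpperWeight u x a b = 0 ↔ ∀ c, 0 < x a c → u a c ≤ u a b := by
  rw [strictUpperWeight, Finset.sum_eq_zero_iff_of_nonneg
    fun c _ => by split_ifs <;> simp [hx.nonneg]]
  refine forall_congr' fun c => ?_
  have := hx.nonneg a c
  grind

theorem IsFractionalStable.upperWeight_le_degree (hx : IsFractionalStable u x) (a b : V) :
    upperWeight u x a b ≤ ∑ c, x a c :=
  Finset.sum_le_sum fun c _ => by split_ifs <;> simp [hx.nonneg]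

theorem IsFractionalStable.strictUpperWeight_le_degree (hx : IsFractionalStable u x) (a b : V) :
    strictUpperWeight u x a b ≤ ∑ c, x a c :=
  Finset.sum_le_sum fun c _ => by split_ifs <;> simp [hx.nonneg]

theorem IsFractionalStable.upperWeight_eq_degree_iff (hx : IsFractionalStable u x)
    {a b : V} : upperWeight u x a b = ∑ c, x a c ↔ ∀ c, 0 < x a c → u a b ≤ u a c := by
  rw [upperWeight, Finset.sum_eq_sum_iff_of_le fun c _ => by split_ifs <;> simp [hx.nonneg]]
  refine forall_congr' fun c => ?_
  have := hx.nonneg a c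
  grind

theorem IsFractionalStable.strictUpperWeight_eq_degree_iff (hx : IsFractionalStable u x)
    {a b : V} : strictUpperWeight u x a b = ∑ c, x a c ↔ ∀ c, 0 < x a c → u a b < u a c := by
  rw [strictUpperWeight, Finset.sum_eq_sum_iff_of_le fun c _ => by split_ifs <;> simp [hx.nonneg]]
  refine forall_congr' fun c => ?_
  have := hx.nonneg a c
  grind

theorem IsFractionalStable.upperWeight_eq_zero_iff (hx : IsFractionalStable u x)
    {a b : V} : upperWeight u x a b = 0 ↔ ∀ c, 0 < x a c → u a c < u a b := by
  rw [upperWeight, Finset.sum_eq_zero_iff_of_nonneg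
    fun c _ => by split_ifs <;> simp [hx.nonneg]]
  refine forall_congr' fun c => ?_
  have := hx.nonneg a c
  grind

theorem upperWeight_sub_strictUpperWeight (u : V → V → ℕ) (x : V → V → ℝ) (a b : V) :
    upperWeight u x a b - strictUpperWeight u x a b =
      ∑ c, if u a c = u a b then x a c else 0 := by
  rw [upperWeight, strictUpperWeight, ← Finset.sum_sub_distrib]
  refine Finset.sum_congr rfl fun c _ => ?_
  grind

open Classical in
/-- The characteristic function of the matching given by `m`. -/
noncomputable def mateWeight (m : V → V) (a b : V) : ℝ := if m a = b ∧ a ≠ b then 1 else 0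

theorem sum_mateWeight (m : V → V) (a : V) (p : V → Prop) [DecidablePred p] :
    ∑ c, (if p c then mateWeight m a c else 0) =
      mateWeight m a (m a) * if p (m a) then 1 else 0 := by
  classical
  rw [Finset.sum_eq_single (m a)]
  · split_ifs <;> simp
  · intro b _ hb
    simp [mateWeight, hb.symm]
  · simp

variable {m : V → V}

theorem upperWeight_mateWeight (hu : ∀ a, u a a = 0) {a b : V} (hab : 0 < u a b) :
    upperWeight u (mateWeight m) a b = if u a b ≤ u a (m a) then 1 else 0 := by
  rw [upperWeight, sum_mateWeight]
  by_cases h : a = m a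
  · rw [← h]
    simp [hu, hab.ne', mateWeight]
  · simp [mateWeight, h]

theorem strictUpperWeight_mateWeight (hu : ∀ a, u a a = 0) {a b : V} :
    strictUpperWeight u (mateWeight m) a b = if u a b < u a (m a) then 1 else 0 := by
  rw [strictUpperWeight, sum_mateWeight]
  by_cases h : a = m a
  · rw [← h]
    simp [hu, mateWeight]
  · simp [mateWeight, h]

theorem isFractionalStable_mateWeight (hu : ∀ a, u a a = 0)
    (hpos : ∀ a b, 0 < u a b → 0 < u b a) (hm : Function.Involutive m)
    (hadj : ∀ a, m a ≠ a → 0 < u a (m a)) (hs : IsStableMate u m) :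
    IsFractionalStable u (mateWeight m) where
  nonneg a b := by unfold mateWeight; split_ifs <;> norm_num
  symm a b := by
    have : (m a = b ∧ a ≠ b) ↔ (m b = a ∧ b ≠ a) := by
      have := hm a
      have := hm b
      grind
    unfold mateWeight
    split_ifs <;> grind
  pos_utility a b h := by
    unfold mateWeight at h
    have := hadj a
    split_ifs at h <;> grind
  degree_le a := by
    have := sum_mateWeight m a (fun _ => True)
    simp only [if_true] at this
    rw [this]
    unfold mateWeight
    split_ifs <;> norm_num
  stable a b hab := by
    rw [upperWeight_mateWeight hu hab, strictUpperWeight_mateWeight hu]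
    have h1 := hs b a (hpos a b hab)
    split_ifs <;> grind

end Fractional

theorem sum_sum_le_card_sub_one_of_odd {V : Type*} {x y : V → V → ℝ} (P Q : V → Prop)
    (symm : ∀ a b, y a b = y b a)
    (row : ∀ (X : Finset V) (a : V), ∑ b ∈ X, y a b ≤ 1)
    (hPQ : ∀ a, P a → ¬ Q a) (hsupp : ∀ a b, y a b ≠ 0 → (P a ↔ Q b))
    (hle : ∀ a b, ¬ P a → ¬ Q a → y a b ≤ x a b)
    (hodd : ∀ X : Finset V, Odd X.card → ∑ a ∈ X, ∑ b ∈ X, x a b ≤ X.card - 1)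
    (X : Finset V) (hX : Odd X.card) : ∑ a ∈ X, ∑ b ∈ X, y a b ≤ X.card - 1 := by
  classical
  set p := X.filter P with hp
  set q := X.filter Q with hq
  set n := X.filter (fun a => ¬ P a ∧ ¬ Q a) with hn
  have hsplit : ∀ f : V → ℝ, ∑ a ∈ X, f a = ∑ a ∈ p, f a + ∑ a ∈ q, f a + ∑ a ∈ n, f a := by
    intro f
    rw [hp, hq, hn, Finset.sum_filter, Finset.sum_filter, Finset.sum_filter,
      ← Finset.sum_add_distrib, ← Finset.sum_add_distrib]
    refine Finset.sum_congr rfl fun a _ => ?_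
    have := hPQ a
    by_cases h1 : P a <;> by_cases h2 : Q a <;> simp_all
  have hcard : X.card = p.card + q.card + n.card := by
    have := hsplit fun _ => 1
    simp only [Finset.sum_const, nsmul_eq_mul, mul_one] at this
    exact_mod_cast this
  have hinner : ∀ (Y : Finset V) (R : V → Prop) [DecidablePred R] (a : V), Y = X.filter R →
      (∀ b, y a b ≠ 0 → R b) → ∑ b ∈ X, y a b = ∑ b ∈ Y, y a b := by
    rintro Y R _ a rfl h
    rw [Finset.sum_filter]
    refine Finset.sum_congr rfl fun b _ => ?_
    by_cases hb : R b
    · simp [hb]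
    · simpa [hb] using fun h' => hb (h b h')
  have hsupp' : ∀ a b, y a b ≠ 0 → (Q a ↔ P b) := fun a b h =>
    (hsupp b a (by rwa [symm])).symm
  have e1 : ∑ a ∈ p, ∑ b ∈ X, y a b = ∑ a ∈ p, ∑ b ∈ q, y a b :=
    Finset.sum_congr rfl fun a ha => hinner _ Q a hq fun b hb =>
      (hsupp a b hb).1 (Finset.mem_filter.1 ha).2
  have e2 : ∑ a ∈ q, ∑ b ∈ X, y a b = ∑ a ∈ q, ∑ b ∈ p, y a b :=
    Finset.sum_congr rfl fun a ha => hinner _ P a hp fun b hb =>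
      (hsupp' a b hb).1 (Finset.mem_filter.1 ha).2
  have e3 : ∑ a ∈ n, ∑ b ∈ X, y a b = ∑ a ∈ n, ∑ b ∈ n, y a b :=
    Finset.sum_congr rfl fun a ha => hinner _ (fun b => ¬ P b ∧ ¬ Q b) a hn fun b hb => by
      have := (Finset.mem_filter.1 ha).2
      grind
  have e4 : ∑ a ∈ q, ∑ b ∈ p, y a b = ∑ a ∈ p, ∑ b ∈ q, y a b := by
    rw [Finset.sum_comm]
    simp only [symm]
  have hrows : ∀ Y Z : Finset V, ∑ a ∈ Y, ∑ b ∈ Z, y a b ≤ Y.card := fun Y Z => by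
    simpa using Finset.sum_le_card_nsmul Y _ 1 fun a _ => row Z a
  have bp := hrows p q
  have bq := hrows q p
  have bn := hrows n n
  rw [e4] at bq
  rw [hsplit, e1, e2, e3, e4]
  rcases Nat.even_or_odd n.card with h | h
  · have hne : p.card + 1 ≤ q.card ∨ q.card + 1 ≤ p.card := by
      rcases lt_trichotomy p.card q.card with h' | h' | h'
      · exact Or.inl h'
      · rw [hcard, h'] at hX
        grind
      · exact Or.inr h'
    rw [hcard]
    push_cast
    rcases hne with h' | h'
    · have : (p.card : ℝ) + 1 ≤ q.card := by exact_mod_cast h'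
      linarith
    · have : (q.card : ℝ) + 1 ≤ p.card := by exact_mod_cast h'
      linarith
  · have h1 := hodd n h
    have h2 : ∑ a ∈ n, ∑ b ∈ n, y a b ≤ ∑ a ∈ n, ∑ b ∈ n, x a b :=
      Finset.sum_le_sum fun a ha => Finset.sum_le_sum fun b _ =>
        hle a b (Finset.mem_filter.1 ha).2.1 (Finset.mem_filter.1 ha).2.2
    rw [hcard]
    push_cast
    linarith

theorem sum_mateWeight_univ {V : Type*} [Fintype V] [DecidableEq V] (m : V → V) (a : V) :
    ∑ b, mateWeight m a b = if m a = a then 0 else 1 := by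
  have := sum_mateWeight m a (fun _ => True)
  simp only [if_true] at this
  rw [this]
  simp [mateWeight, eq_comm]

section Selection

variable {V : Type*} [Fintype V]

/-- Some partner in the support of `x` is strictly better for `a` than its mate. -/
def HasBetter (u : V → V → ℕ) (x : V → V → ℝ) (m : V → V) (a : V) : Prop :=
  ∃ c, 0 < x a c ∧ u a (m a) < u a c

/-- Some partner in the support of `x` is strictly worse for `a` than its mate. -/
def HasWorse (u : V → V → ℕ) (x : V → V → ℝ) (m : V → V) (a : V) : Prop :=
  ∃ c, 0 < x a c ∧ u a c < u a (m a)

/-- `b` is a best partner of `a` in the support of `x`. -/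
def IsBestIn (u : V → V → ℕ) (x : V → V → ℝ) (a b : V) : Prop :=
  ∀ c, 0 < x a c → u a c ≤ u a b

/-- `b` is a worst partner of `a` in the support of `x`. -/
def IsWorstIn (u : V → V → ℕ) (x : V → V → ℝ) (a b : V) : Prop :=
  ∀ c, 0 < x a c → u a b ≤ u a c

/-- The partners to which `a` may be rematched: its best ones in the support of `x` if its mate
is weakly better than all of them and strictly better than some, its worst ones if its mate is
weakly worse than all of them, and none otherwise. -/
def CanRematch (u : V → V → ℕ) (x : V → V → ℝ) (m : V → V) (a b : V) : Prop :=
  0 < x a b ∧ ((HasWorse u x m a ∧ ¬ HasBetter u x m a ∧ IsBestIn u x a b) ∨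
    (¬ HasWorse u x m a ∧ IsWorstIn u x a b))

/-- The `x`-weight at `a` of the partners that `a` ranks equally with `b`. -/
def tieWeight (u : V → V → ℕ) (x : V → V → ℝ) (a b : V) : ℝ :=
  ∑ c, if u a c = u a b then x a c else 0

variable {u : V → V → ℕ} {x : V → V → ℝ} {m : V → V}

theorem IsFractionalStable.isWorstIn_iff_isBestIn (hx : IsFractionalStable u x)
    (hdeg : ∀ a b, 0 < x a b → ∑ c, x a c = 1) {a b : V} (h : 0 < x a b) :
    IsWorstIn u x a b ↔ IsBestIn u x b a := by
  have h1 := hx.tight hx h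
  rw [IsWorstIn, IsBestIn, ← hx.upperWeight_eq_degree_iff, ← hx.strictUpperWeight_eq_zero_iff,
    hdeg a b h]
  constructor <;> intro <;> linarith

theorem IsFractionalStable.tieWeight_comm (hx : IsFractionalStable u x) {a b : V}
    (h : 0 < x a b) : tieWeight u x a b = tieWeight u x b a := by
  have h1 := hx.tight hx h
  have h2 := hx.tight hx (hx.symm a b ▸ h)
  rw [tieWeight, tieWeight, ← upperWeight_sub_strictUpperWeight,
    ← upperWeight_sub_strictUpperWeight]
  linarith

theorem IsFractionalStable.tieWeight_pos (hx : IsFractionalStable u x) {a b : V}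
    (h : 0 < x a b) : 0 < tieWeight u x a b :=
  Finset.sum_pos' (fun c _ => by split_ifs <;> simp [hx.nonneg])
    ⟨b, Finset.mem_univ b, by simpa using h⟩

/-- In the support of `x`, one endpoint weakly prefers its mate exactly when the other one
weakly prefers the edge. -/
def IsOpposed (u : V → V → ℕ) (x : V → V → ℝ) (m : V → V) : Prop :=
  ∀ a b, 0 < x a b → (u a b ≤ u a (m a) ↔ u b (m b) ≤ u b a)

theorem IsFractionalStable.isOpposed (hx : IsFractionalStable u x)
    (hm : IsFractionalStable u (mateWeight m)) (hu : ∀ a, u a a = 0) : IsOpposed u x m := by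
  intro a b h
  have h1 := hm.tight hx h
  rw [upperWeight_mateWeight hu (hx.pos_utility a b h), strictUpperWeight_mateWeight hu] at h1
  by_cases h2 : u a b ≤ u a (m a) <;> by_cases h3 : u b a < u b (m b) <;>
    simp [h2, h3] at h1 <;> grind

theorem CanRematch.hasBetter_iff (hx : IsFractionalStable u x)
    (hdeg : ∀ a b, 0 < x a b → ∑ c, x a c = 1) (hopp : IsOpposed u x m) {a b : V}
    (h : CanRematch u x m a b) :
    (HasWorse u x m a ↔ HasBetter u x m b) ∧ (HasBetter u x m a ↔ HasWorse u x m b) := by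
  have hab := h.1
  have hba : 0 < x b a := hx.symm a b ▸ hab
  have h1 := hx.isWorstIn_iff_isBestIn hdeg hab
  have h2 := hx.isWorstIn_iff_isBestIn hdeg hba
  have h3 := hopp a b hab
  have h4 := hopp b a hba
  unfold CanRematch HasWorse HasBetter IsWorstIn IsBestIn at *
  grind

theorem CanRematch.symm (hx : IsFractionalStable u x)
    (hdeg : ∀ a b, 0 < x a b → ∑ c, x a c = 1) (hopp : IsOpposed u x m) {a b : V}
    (h : CanRematch u x m a b) : CanRematch u x m b a := by
  have hab := h.1
  have hba : 0 < x b a := hx.symm a b ▸ hab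
  have h1 := hx.isWorstIn_iff_isBestIn hdeg hab
  have h2 := hx.isWorstIn_iff_isBestIn hdeg hba
  have h3 := h.hasBetter_iff hx hdeg hopp
  obtain ⟨-, h⟩ := h
  refine ⟨hba, ?_⟩
  rcases h with ⟨h4, h5, h6⟩ | ⟨h4, h5⟩
  · exact Or.inr ⟨fun h => h5 (h3.2.2 h), h2.2 h6⟩
  · by_cases h6 : HasWorse u x m b
    · exact Or.inl ⟨h6, fun h => h4 (h3.1.2 h), h1.1 h5⟩
    · refine Or.inr ⟨h6, h2.2 fun c hc => ?_⟩
      have h7 : ¬ HasBetter u x m a := fun h => h6 (h3.2.1 h)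
      unfold HasBetter at h7
      unfold HasWorse at h4
      grind

theorem IsFractionalStable.sum_eq_of_mate (hx : IsFractionalStable u x)
    (hm : IsFractionalStable u (mateWeight m)) :
    (∀ a, m a ≠ a → ∑ c, x a c = 1) ∧ ∀ a b, 0 < x a b → m a ≠ a := by
  classical
  have h : ∀ a, (m a ≠ a → ∑ c, x a c = 1) ∧ (m a = a → ∑ c, x a c = 0) := by
    intro a
    have := hx.degree_tight hm a
    rw [sum_mateWeight_univ] at this
    constructor <;> intro h <;> simp [h] at this <;> linarith
  refine ⟨fun a => (h a).1, fun a b hab hma => ?_⟩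
  have := (Finset.sum_eq_zero_iff_of_nonneg fun c _ => hx.nonneg a c).1 ((h a).2 hma) b
    (Finset.mem_univ b)
  exact hab.ne' this

theorem IsFractionalStable.hasWorse_iff_hasBetter_mate (hx : IsFractionalStable u x)
    (hm : IsFractionalStable u (mateWeight m)) (hinv : Function.Involutive m) {a : V}
    (ha : m a ≠ a) : HasWorse u x m a ↔ HasBetter u x m (m a) := by
  have h1 : 0 < mateWeight m a (m a) := by simp [mateWeight, ha.symm]
  have h2 := hx.tight hm h1
  have h3 := hx.upperWeight_eq_degree_iff (a := a) (b := m a)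
  have h4 := hx.strictUpperWeight_eq_zero_iff (a := m a) (b := a)
  rw [(hx.sum_eq_of_mate hm).1 a ha] at h3
  have h5 : (∀ c, 0 < x a c → u a (m a) ≤ u a c) ↔ ∀ c, 0 < x (m a) c → u (m a) c ≤ u (m a) a := by
    rw [← h3, ← h4]
    constructor <;> intro <;> linarith
  unfold HasWorse HasBetter
  rw [hinv a]
  rw [← not_iff_not]
  push Not
  exact h5

open Classical in
/-- The weight `x` restricted to the admissible rematching edges and rescaled so that every
vertex admitting a rematching has degree one. -/
noncomputable def rematchWeight (u : V → V → ℕ) (x : V → V → ℝ) (m : V → V) (a b : V) : ℝ :=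
  if CanRematch u x m a b then x a b / tieWeight u x a b else 0

theorem exists_canRematch {a : V} (hdeg : ∑ c, x a c = 1)
    (hnonneg : ∀ c, 0 ≤ x a c) (ha : ¬ (HasBetter u x m a ∧ HasWorse u x m a)) :
    ∃ b, CanRematch u x m a b := by
  classical
  have hne : (univ.filter fun c => 0 < x a c).Nonempty := by
    by_contra h
    rw [Finset.not_nonempty_iff_eq_empty, Finset.filter_eq_empty_iff] at h
    rw [Finset.sum_eq_zero fun c hc => le_antisymm (not_lt.1 (h hc)) (hnonneg c)] at hdeg
    norm_num at hdeg
  obtain ⟨b, hb, hb'⟩ := Finset.exists_max_image _ (u a) hne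
  obtain ⟨d, hd, hd'⟩ := Finset.exists_min_image _ (u a) hne
  simp only [Finset.mem_filter, Finset.mem_univ, true_and] at hb hb' hd hd'
  by_cases h : HasWorse u x m a
  · exact ⟨b, hb, Or.inl ⟨h, fun h' => ha ⟨h', h⟩, hb'⟩⟩
  · exact ⟨d, hd, Or.inr ⟨h, hd'⟩⟩

omit [Fintype V] in
theorem CanRematch.iff_eq {a b c : V} (h : CanRematch u x m a b) :
    CanRematch u x m a c ↔ 0 < x a c ∧ u a c = u a b := by
  unfold CanRematch IsBestIn IsWorstIn at *
  grind

theorem IsFractionalStable.sum_rematchWeight (hx : IsFractionalStable u x) {a b : V}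
    (h : CanRematch u x m a b) : ∑ c, rematchWeight u x m a c = 1 := by
  have hpos := hx.tieWeight_pos h.1
  rw [← div_self hpos.ne']
  nth_rw 1 [tieWeight]
  rw [Finset.sum_div]
  refine Finset.sum_congr rfl fun c _ => ?_
  rw [rematchWeight, h.iff_eq]
  rcases (hx.nonneg a c).eq_or_lt with h0 | h0
  · simp [← h0]
  · by_cases hc : u a c = u a b
    · simp [h0, hc, tieWeight]
    · simp [hc]

theorem IsFractionalStable.rematchWeight_nonneg (hx : IsFractionalStable u x) (a b : V) :
    0 ≤ rematchWeight u x m a b := by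
  unfold rematchWeight
  split_ifs with h
  · exact div_nonneg (hx.nonneg a b) (hx.tieWeight_pos h.1).le
  · rfl

theorem canRematch_of_rematchWeight_ne_zero {a b : V} (h : rematchWeight u x m a b ≠ 0) :
    CanRematch u x m a b := by
  by_contra h'
  simp [rematchWeight, h'] at h

theorem IsFractionalStable.rematchWeight_symm (hx : IsFractionalStable u x)
    (hdeg : ∀ a b, 0 < x a b → ∑ c, x a c = 1) (hopp : IsOpposed u x m) (a b : V) :
    rematchWeight u x m a b = rematchWeight u x m b a := by
  by_cases h : CanRematch u x m a b
  · rw [rematchWeight, rematchWeight, if_pos h, if_pos (h.symm hx hdeg hopp), hx.symm,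
      hx.tieWeight_comm h.1]
  · rw [rematchWeight, rematchWeight, if_neg h, if_neg fun h' => h (h'.symm hx hdeg hopp)]

theorem IsFractionalStable.sum_rematchWeight_le_one (hx : IsFractionalStable u x)
    (X : Finset V) (a : V) : ∑ b ∈ X, rematchWeight u x m a b ≤ 1 := by
  by_cases h : ∃ b, CanRematch u x m a b
  · obtain ⟨b, hb⟩ := h
    rw [← hx.sum_rematchWeight hb]
    exact Finset.sum_le_sum_of_subset_of_nonneg (Finset.subset_univ X)
      fun c _ _ => hx.rematchWeight_nonneg a c
  · have h0 : ∀ b, rematchWeight u x m a b = 0 := fun b => if_neg fun hb => h ⟨b, hb⟩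
    simp [h0]

theorem IsFractionalStable.rematchWeight_le (hx : IsFractionalStable u x)
    (hdeg : ∀ a b, 0 < x a b → ∑ c, x a c = 1) {a : V} (hB : ¬ HasBetter u x m a)
    (hW : ¬ HasWorse u x m a) (b : V) : rematchWeight u x m a b ≤ x a b := by
  unfold rematchWeight
  split_ifs with h
  · have h1 : tieWeight u x a b = 1 := by
      rw [← hdeg a b h.1]
      refine Finset.sum_congr rfl fun c _ => ?_
      have h0 := hx.nonneg a c
      have h1 := h.1
      unfold HasBetter at hB
      unfold HasWorse at hW
      push Not at hB hW
      have := hB b h1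
      have := hB c
      have := hW b h1
      have := hW c
      grind
    rw [h1, div_one]
  · exact hx.nonneg a b

theorem IsFractionalStable.exists_rematching (hx : IsFractionalStable u x)
    (hm : IsFractionalStable u (mateWeight m)) (hu : ∀ a, u a a = 0)
    (hinv : Function.Involutive m)
    (hodd : ∀ X : Finset V, Odd X.card → ∑ a ∈ X, ∑ b ∈ X, x a b ≤ X.card - 1) :
    ∃ m' : V → V, Function.Involutive m' ∧
      (∀ a, m a ≠ a → ¬ (HasBetter u x m a ∧ HasWorse u x m a) → CanRematch u x m a (m' a)) ∧
      ∀ a, (m a = a ∨ (HasBetter u x m a ∧ HasWorse u x m a)) → m' a = m a := by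
  classical
  obtain ⟨hdeg', hmatched⟩ := hx.sum_eq_of_mate hm
  have hdeg : ∀ a b, 0 < x a b → ∑ c, x a c = 1 := fun a b h => hdeg' a (hmatched a b h)
  have hopp := hx.isOpposed hm hu
  let A := {a : V // m a ≠ a ∧ ¬ (HasBetter u x m a ∧ HasWorse u x m a)}
  have hright : ∀ a b, rematchWeight u x m a b ≠ 0 →
      m b ≠ b ∧ ¬ (HasBetter u x m b ∧ HasWorse u x m b) := by
    intro a b h
    have h1 := (canRematch_of_rematchWeight_ne_zero h).symm hx hdeg hopp
    refine ⟨hmatched b a h1.1, ?_⟩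
    rcases h1.2 with h2 | h2
    · exact fun h => h2.2.1 h.1
    · exact fun h => h2.1 h.2
  obtain ⟨f, hf, hf'⟩ := exists_involution_of_fractional_perfect_matching
    (fun a b : A => rematchWeight u x m a b) (fun a b => hx.rematchWeight_nonneg a b)
    (fun a b => hx.rematchWeight_symm hdeg hopp a b)
    (fun a => by
      by_contra h
      have h1 := hx.pos_utility _ _ (canRematch_of_rematchWeight_ne_zero h).1
      simp [hu] at h1)
    (fun a => by
      obtain ⟨b, hb⟩ := exists_canRematch (hdeg' a a.2.1) (hx.nonneg a) a.2.2
      rw [← hx.sum_rematchWeight hb]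
      refine Fintype.sum_of_injective _ Subtype.val_injective _ _ (fun b hb => ?_) fun _ => rfl
      by_contra h
      exact hb ⟨⟨b, hright a b h⟩, rfl⟩)
    (fun X hX => by
      have h1 := sum_sum_le_card_sub_one_of_odd
        (fun a => HasWorse u x m a ∧ ¬ HasBetter u x m a)
        (fun a => HasBetter u x m a ∧ ¬ HasWorse u x m a)
        (hx.rematchWeight_symm hdeg hopp) (hx.sum_rematchWeight_le_one (m := m))
        (fun a h h' => h'.2 h.1)
        (fun a b h => by
          have := (canRematch_of_rematchWeight_ne_zero h).hasBetter_iff hx hdeg hopp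
          tauto)
        (fun a b hW hB => by
          by_cases h : HasBetter u x m a
          · rw [rematchWeight, if_neg]
            · exact hx.nonneg a b
            · unfold CanRematch
              tauto
          · exact hx.rematchWeight_le hdeg h (by tauto) b) hodd
        (X.map (Function.Embedding.subtype _)) (by simpa using hX)
      simpa using h1)
  have hstep : ∀ a, m a ≠ a ∧ ¬ (HasBetter u x m a ∧ HasWorse u x m a) →
      m (m a) ≠ m a ∧ ¬ (HasBetter u x m (m a) ∧ HasWorse u x m (m a)) := by
    intro a ⟨h1, h2⟩
    have h3 : m (m a) ≠ m a := by rw [hinv a]; exact h1.symm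
    have h4 := hx.hasWorse_iff_hasBetter_mate hm hinv h1
    have h5 := hx.hasWorse_iff_hasBetter_mate hm hinv h3
    rw [hinv a] at h5
    tauto
  refine ⟨fun a => if h : m a ≠ a ∧ ¬ (HasBetter u x m a ∧ HasWorse u x m a) then
    (f ⟨a, h⟩ : V) else m a, fun a => ?_, fun a h1 h2 => ?_, fun a h => ?_⟩
  · by_cases h : m a ≠ a ∧ ¬ (HasBetter u x m a ∧ HasWorse u x m a)
    · simp only [dif_pos h, dif_pos (f ⟨a, h⟩).2, Subtype.coe_eta, hf ⟨a, h⟩]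
    · have h' : ¬ (m (m a) ≠ m a ∧ ¬ (HasBetter u x m (m a) ∧ HasWorse u x m (m a))) :=
        fun h' => h (by simpa only [hinv a] using hstep (m a) h')
      simp only [dif_neg h]
      rw [dif_neg h', hinv a]
  · beta_reduce
    rw [dif_pos ⟨h1, h2⟩]
    exact canRematch_of_rematchWeight_ne_zero (hf' ⟨a, h1, h2⟩).ne'
  · beta_reduce
    rw [dif_neg (by tauto)]

theorem IsFractionalStable.exists_stableMate (hx : IsFractionalStable u x)
    (hu : ∀ a, u a a = 0) (hpos : ∀ a b, 0 < u a b → 0 < u b a)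
    (hodd : ∀ X : Finset V, Odd X.card → ∑ a ∈ X, ∑ b ∈ X, x a b ≤ X.card - 1)
    (hinv : Function.Involutive m) (hadj : ∀ a, m a ≠ a → 0 < u a (m a))
    (hstable : IsStableMate u m) :
    ∃ m' : V → V, Function.Involutive m' ∧ (∀ a, m' a ≠ a → 0 < u a (m' a)) ∧
      IsStableMate u m' ∧
      ∀ a, m' a ≠ a →
        (0 < x a (m' a) ∧ (IsBestIn u x a (m' a) ∨ IsWorstIn u x a (m' a))) ∨
          (HasBetter u x m' a ∧ HasWorse u x m' a) := by
  have hm := isFractionalStable_mateWeight hu hpos hinv hadj hstable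
  obtain ⟨hdeg, hmatched⟩ := hx.sum_eq_of_mate hm
  obtain ⟨m', hinv', hre, hsame⟩ := hx.exists_rematching hm hu hinv hodd
  have hworse : ∀ a b c, 0 < x a b → (∀ d, 0 < x a d → u a c ≤ u a d) → u a c ≤ u a (m' a) := by
    intro a b c hab hc
    by_cases h : HasBetter u x m a ∧ HasWorse u x m a
    · obtain ⟨d, hd, hd'⟩ := h.2
      rw [hsame a (Or.inr h)]
      exact (hc d hd).trans hd'.le
    · exact hc _ (hre a (hmatched a b hab) h).1
  have hge : ∀ a, (m a ≠ a ∧ ¬ HasBetter u x m a ∧ HasWorse u x m a) ∨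
      u a (m a) ≤ u a (m' a) := by
    intro a
    by_cases h : m a = a ∨ (HasBetter u x m a ∧ HasWorse u x m a)
    · exact Or.inr (by rw [hsame a h])
    · rw [not_or] at h
      by_cases hW : HasWorse u x m a
      · exact Or.inl ⟨h.1, fun hB => h.2 ⟨hB, hW⟩, hW⟩
      · refine Or.inr (not_lt.1 fun h' => hW ⟨m' a, (hre a h.1 h.2).1, h'⟩)
  have hbest : ∀ a, m a ≠ a ∧ ¬ HasBetter u x m a ∧ HasWorse u x m a →
      IsBestIn u x a (m' a) := by
    intro a ⟨h1, h2, h3⟩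
    have := (hre a h1 (fun h => h2 h.1)).2
    tauto
  have hexists : ∀ a, 0 < ∑ c, x a c → ∃ b, 0 < x a b := by
    intro a h
    by_contra! h'
    exact h.not_ge (Finset.sum_nonpos fun c _ => h' c)
  refine ⟨m', hinv', fun a ha => ?_, fun a b hab => ?_, fun a ha => ?_⟩
  · by_cases h : m a = a ∨ (HasBetter u x m a ∧ HasWorse u x m a)
    · rw [hsame a h] at ha ⊢
      exact hadj a ha
    · rw [not_or] at h
      exact hx.pos_utility _ _ (hre a h.1 h.2).1
  · by_contra! hblock
    obtain ⟨h1, h2⟩ := hblock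
    rcases hge a with ha | ha
    · have h3 := hx.strictUpperWeight_eq_zero_iff.2 fun c hc => (hbest a ha c hc).trans h1
      have h4 := hx.stable b a (hpos a b hab)
      have h5 := hx.upperWeight_le_degree b a
      have h6 := hx.degree_le b
      obtain ⟨c, hc⟩ := hexists b (by linarith)
      exact h2.not_ge (hworse b c a hc (hx.upperWeight_eq_degree_iff.1 (by linarith)))
    rcases hge b with hb | hb
    · have h3 := hx.upperWeight_eq_zero_iff.2 fun c hc => (hbest b hb c hc).trans_lt h2
      have h4 := hx.stable b a (hpos a b hab)
      have h5 := hx.strictUpperWeight_le_degree a b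
      have h6 := hx.degree_le a
      obtain ⟨c, hc⟩ := hexists a (by linarith)
      have h7 := hx.strictUpperWeight_eq_degree_iff.1
        (show strictUpperWeight u x a b = ∑ c, x a c by linarith)
      by_cases h : HasBetter u x m a ∧ HasWorse u x m a
      · obtain ⟨d, hd, hd'⟩ := h.2
        rw [← hsame a (Or.inr h)] at hd'
        have := h7 d hd
        omega
      · have := h7 _ (hre a (hmatched a c hc) h).1
        omega
    · rcases hstable a b hab with h | h <;> omega
  · by_cases h : m a = a ∨ (HasBetter u x m a ∧ HasWorse u x m a)
    · have h' := hsame a h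
      rcases h with h | h
      · exact absurd (h'.trans h) ha
      · unfold HasBetter HasWorse at *
        rw [h']
        exact Or.inr h
    · rw [not_or] at h
      have := hre a h.1 h.2
      unfold CanRematch at this
      tauto

end Selection

namespace RSetup

section Translation

variable {V : Type*} [Fintype V] [DecidableEq V] (S : RSetup V)

open Classical in
/-- The number of neighbours of `v` that are weakly worse for `v` than `a`, or `0` if `a` is not
a neighbour of `v`. -/
noncomputable def utility (v a : V) : ℕ :=
  if s(v, a) ∈ S.E then
    (univ.filter fun c => s(v, c) ∈ S.E ∧ S.pref v (some s(v, a)) (some s(v, c))).card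
  else 0

variable {S}

theorem some_edge_spec {v a : V} (h : s(v, a) ∈ S.E) :
    ∀ e, some s(v, a) = some e → e ∈ S.E ∧ v ∈ e := by
  rintro e ⟨⟩
  exact ⟨h, Sym2.mem_mk_left v a⟩

theorem pref_refl {v a : V} (h : s(v, a) ∈ S.E) : S.pref v (some s(v, a)) (some s(v, a)) :=
  (or_self_iff).1 (S.pref_total v _ _ (some_edge_spec h) (some_edge_spec h))

theorem utility_le_iff {v a b : V} (ha : s(v, a) ∈ S.E) (hb : s(v, b) ∈ S.E) :
    S.utility v b ≤ S.utility v a ↔ S.pref v (some s(v, a)) (some s(v, b)) := by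
  classical
  have hmono : ∀ {a b : V}, s(v, a) ∈ S.E → s(v, b) ∈ S.E →
      S.pref v (some s(v, a)) (some s(v, b)) →
      (univ.filter fun c => s(v, c) ∈ S.E ∧ S.pref v (some s(v, b)) (some s(v, c))) ⊆
        univ.filter fun c => s(v, c) ∈ S.E ∧ S.pref v (some s(v, a)) (some s(v, c)) := by
    intro a b ha hb h c hc
    simp only [Finset.mem_filter, Finset.mem_univ, true_and] at hc ⊢
    exact ⟨hc.1, S.pref_trans v _ _ _ (some_edge_spec ha) (some_edge_spec hb)
      (some_edge_spec hc.1) h hc.2⟩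
  rw [utility, utility, if_pos ha, if_pos hb]
  refine ⟨fun h => ?_, fun h => Finset.card_le_card (hmono ha hb h)⟩
  by_contra hab
  have hba := (S.pref_total v _ _ (some_edge_spec ha) (some_edge_spec hb)).resolve_left hab
  refine h.not_gt (Finset.card_lt_card ((Finset.ssubset_iff_of_subset (hmono hb ha hba)).2
    ⟨b, ?_, ?_⟩))
  · simpa using ⟨hb, pref_refl hb⟩
  · simpa using fun _ => hab

theorem utility_lt_iff {v a b : V} (ha : s(v, a) ∈ S.E) (hb : s(v, b) ∈ S.E) :
    S.utility v b < S.utility v a ↔ S.SPref v (some s(v, a)) (some s(v, b)) := by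
  rw [SPref, ← utility_le_iff ha hb, ← utility_le_iff hb ha]
  omega

theorem utility_eq_iff {v a b : V} (ha : s(v, a) ∈ S.E) (hb : s(v, b) ∈ S.E) :
    S.utility v a = S.utility v b ↔ S.IPref v (some s(v, a)) (some s(v, b)) := by
  rw [IPref, ← utility_le_iff ha hb, ← utility_le_iff hb ha]
  omega

theorem utility_pos_iff {v a : V} : 0 < S.utility v a ↔ s(v, a) ∈ S.E := by
  classical
  by_cases h : s(v, a) ∈ S.E
  · rw [utility, if_pos h, Finset.card_pos]
    refine iff_of_true ?_ h
    exact ⟨a, by simpa using ⟨h, pref_refl h⟩⟩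
  · simp [utility, h]

theorem utility_self (v : V) : S.utility v v = 0 := by
  by_contra h
  exact S.not_diag _ (utility_pos_iff.1 (Nat.pos_of_ne_zero h)) rfl

theorem utility_pos_symm (a b : V) (h : 0 < S.utility a b) : 0 < S.utility b a := by
  rw [utility_pos_iff] at *
  rwa [Sym2.eq_swap]

/-- `m` sends each vertex to its partner in `μ`, and fixes the unmatched vertices. -/
def IsMateOf (μ : Finset (Sym2 V)) (m : V → V) : Prop :=
  ∀ a b, s(a, b) ∈ μ ↔ m a = b ∧ a ≠ b

theorem IsMatching.exists_mate {μ : Finset (Sym2 V)} (hμ : S.IsMatching μ) :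
    ∃ m : V → V, Function.Involutive m ∧ IsMateOf μ m := by
  classical
  have huniq : ∀ a b c, s(a, b) ∈ μ → s(a, c) ∈ μ → b = c := by
    intro a b c hb hc
    have := Finset.card_le_one.1 (hμ.2 a) s(a, b) (by simp [inc, hb]) s(a, c) (by simp [inc, hc])
    exact Sym2.congr_right.1 this
  have hne : ∀ a b, s(a, b) ∈ μ → a ≠ b := fun a b h hab => S.not_diag _ (hμ.1 h) hab
  let m : V → V := fun a => if h : ∃ b, s(a, b) ∈ μ then h.choose else a
  have hm : IsMateOf μ m := by
    intro a b
    by_cases h : ∃ b, s(a, b) ∈ μ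
    · have h1 : m a = h.choose := dif_pos h
      rw [h1]
      constructor
      · exact fun hb => ⟨huniq a _ _ h.choose_spec hb, hne a b hb⟩
      · rintro ⟨rfl, -⟩
        exact h.choose_spec
    · have h1 : m a = a := dif_neg h
      rw [h1]
      exact ⟨fun hb => absurd ⟨b, hb⟩ h, fun hb => absurd hb.1 hb.2⟩
  refine ⟨m, fun a => ?_, hm⟩
  by_cases h : m a = a
  · rw [h, h]
  · have h1 := (hm a (m a)).2 ⟨rfl, Ne.symm h⟩
    rw [Sym2.eq_swap] at h1
    exact ((hm _ _).1 h1).1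

theorem exists_isMatching_of_mate {m : V → V} (hm : Function.Involutive m)
    (hadj : ∀ a, m a ≠ a → s(a, m a) ∈ S.E) :
    ∃ μ : Finset (Sym2 V), S.IsMatching μ ∧ IsMateOf μ m := by
  let μ : Finset (Sym2 V) := (univ.filter fun a => m a ≠ a).image fun a => s(a, m a)
  have hmate : IsMateOf μ m := by
    intro a b
    simp only [μ, Finset.mem_image, Finset.mem_filter, Finset.mem_univ, true_and, Sym2.eq_iff]
    constructor
    · rintro ⟨c, hc, ⟨rfl, rfl⟩ | ⟨rfl, rfl⟩⟩
      · exact ⟨rfl, hc.symm⟩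
      · exact ⟨hm _, hc⟩
    · rintro ⟨rfl, h⟩
      exact ⟨a, h.symm, Or.inl ⟨rfl, rfl⟩⟩
  refine ⟨μ, ⟨fun e he => ?_, fun v => ?_⟩, hmate⟩
  · obtain ⟨a, ha, rfl⟩ := Finset.mem_image.1 he
    exact hadj a (Finset.mem_filter.1 ha).2
  · rw [Finset.card_le_one]
    have h : ∀ e ∈ inc μ v, e = s(v, m v) := by
      intro e he
      obtain ⟨he, hv⟩ := Finset.mem_filter.1 he
      obtain ⟨b, rfl⟩ := Sym2.mem_iff_exists.1 hv
      rw [((hmate v b).1 he).1]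
    exact fun e he f hf => (h e he).trans (h f hf).symm

variable {μ : Finset (Sym2 V)} {m : V → V}

omit [Fintype V] in
theorem IsMateOf.matchOf_eq (hm : IsMateOf μ m) (v : V) :
    matchOf μ v = if m v = v then none else some s(v, m v) := by
  have h : ∀ e, e ∈ inc μ v ↔ m v ≠ v ∧ e = s(v, m v) := by
    intro e
    rw [inc, Finset.mem_filter]
    constructor
    · rintro ⟨he, hv⟩
      obtain ⟨b, rfl⟩ := Sym2.mem_iff_exists.1 hv
      obtain ⟨rfl, h⟩ := (hm v b).1 he
      exact ⟨h.symm, rfl⟩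
    · rintro ⟨h, rfl⟩
      exact ⟨(hm v _).2 ⟨rfl, h.symm⟩, Sym2.mem_mk_left _ _⟩
  split_ifs with hv
  · have : inc μ v = ∅ := Finset.eq_empty_of_forall_notMem fun e he => ((h e).1 he).1 hv
    simp [matchOf, this]
  · have : inc μ v = {s(v, m v)} := by
      ext e
      simp [h, hv]
    simp [matchOf, this]

theorem IsMateOf.pref_matchOf_iff (hm : IsMateOf μ m) (hμ : μ ⊆ S.E) {v a : V}
    (ha : s(v, a) ∈ S.E) :
    (S.pref v (some s(v, a)) (matchOf μ v) ↔ S.utility v (m v) ≤ S.utility v a) ∧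
      (S.pref v (matchOf μ v) (some s(v, a)) ↔ S.utility v a ≤ S.utility v (m v)) := by
  rw [hm.matchOf_eq]
  split_ifs with hv
  · have h1 := S.pref_none v _ ha (Sym2.mem_mk_left v a)
    have h2 := utility_pos_iff.2 ha
    rw [hv, utility_self]
    exact ⟨by simp [h1.1], by simp [h1.2, h2.ne']⟩
  · have hv' := hμ ((hm v (m v)).2 ⟨rfl, Ne.symm hv⟩)
    exact ⟨(utility_le_iff ha hv').symm, (utility_le_iff hv' ha).symm⟩

theorem IsMateOf.stronglyStable_iff (hm : IsMateOf μ m) (hμ : S.IsMatching μ) :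
    S.StronglyStable μ ↔ IsStableMate S.utility m := by
  have hpref : ∀ {v a : V}, s(v, a) ∈ S.E →
      (S.pref v (some s(v, a)) (matchOf μ v) ↔ S.utility v (m v) ≤ S.utility v a) :=
    fun ha => (hm.pref_matchOf_iff hμ.1 ha).1
  have hspref : ∀ {v a : V}, s(v, a) ∈ S.E →
      (S.SPref v (some s(v, a)) (matchOf μ v) ↔ S.utility v (m v) < S.utility v a) := by
    intro v a ha
    have := hm.pref_matchOf_iff hμ.1 ha
    rw [SPref, this.1, this.2]
    omega
  constructor
  · intro h a b hab
    by_contra! hlt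
    have ha := utility_pos_iff.1 hab
    have hb : s(b, a) ∈ S.E := by rwa [Sym2.eq_swap]
    refine h.2 s(a, b) ⟨ha, fun hmem => ?_, fun v hv => ?_,
      b, Sym2.mem_mk_right a b, ?_⟩
    · rw [Sym2.eq_swap, hm] at hmem
      rw [hmem.1] at hlt
      exact lt_irrefl _ hlt.2
    · rcases Sym2.mem_iff.1 hv with rfl | rfl
      · exact (hpref ha).2 hlt.1
      · rw [Sym2.eq_swap]
        exact (hpref hb).2 hlt.2.le
    · rw [Sym2.eq_swap]
      exact (hspref hb).2 hlt.2
  · rintro h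
    refine ⟨hμ, ?_⟩
    rintro e ⟨he, -, hall, v, hv, hlt⟩
    obtain ⟨a, rfl⟩ := Sym2.mem_iff_exists.1 hv
    have h1 := (hspref he).1 hlt
    have h2 := hall a (Sym2.mem_mk_right v a)
    rw [Sym2.eq_swap] at he h2
    have := h a v (utility_pos_iff.2 he)
    have := (hpref he).1 h2
    omega

theorem sum_inc_filter (S : RSetup V) (z : Sym2 V → ℝ) (v : V) (p : Sym2 V → Prop)
    [DecidablePred p] :
    ∑ e ∈ (inc S.E v).filter p, z e =
      ∑ a, if s(v, a) ∈ S.E ∧ p s(v, a) then z s(v, a) else 0 := by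
  have h : (inc S.E v).filter p =
      (univ.filter fun a => s(v, a) ∈ S.E ∧ p s(v, a)).image fun a => s(v, a) := by
    ext e
    simp only [inc, Finset.mem_filter, Finset.mem_image, Finset.mem_univ, true_and]
    constructor
    · rintro ⟨⟨he, hv⟩, hp⟩
      obtain ⟨a, rfl⟩ := Sym2.mem_iff_exists.1 hv
      exact ⟨a, ⟨he, hp⟩, rfl⟩
    · rintro ⟨a, ⟨he, hp⟩, rfl⟩
      exact ⟨⟨he, Sym2.mem_mk_left _ _⟩, hp⟩
  rw [h, Finset.sum_image fun a _ b _ hab => Sym2.congr_right.1 hab, Finset.sum_filter]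

theorem IsVec.xS_inc {z : Sym2 V → ℝ} (hz : S.IsVec z) (v : V) :
    xS z (inc S.E v) = ∑ a, z s(v, a) := by
  have := S.sum_inc_filter z v (fun _ => True)
  rw [Finset.filter_true] at this
  rw [xS, this]
  refine Finset.sum_congr rfl fun a _ => ?_
  have := hz.2 s(v, a)
  grind

theorem IsVec.xS_succSet {z : Sym2 V → ℝ} (hz : S.IsVec z) {v w : V} (h : s(v, w) ∈ S.E) :
    xS z (S.succSet v s(v, w)) = strictUpperWeight S.utility (fun a b => z s(a, b)) v w := by
  classical
  rw [xS, succSet, sum_inc_filter, strictUpperWeight]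
  refine Finset.sum_congr rfl fun a _ => ?_
  by_cases ha : s(v, a) ∈ S.E
  · simp [ha, utility_lt_iff ha h]
  · simp [ha, hz.2 _ ha]

theorem IsVec.xS_simSet_add_succSet {z : Sym2 V → ℝ} (hz : S.IsVec z) {v w : V}
    (h : s(v, w) ∈ S.E) : xS z (S.simSet v s(v, w)) + xS z (S.succSet v s(v, w)) =
      upperWeight S.utility (fun a b => z s(a, b)) v w := by
  classical
  rw [xS, xS, simSet, succSet, sum_inc_filter, sum_inc_filter, upperWeight,
    ← Finset.sum_add_distrib]
  refine Finset.sum_congr rfl fun a _ => ?_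
  by_cases ha : s(v, a) ∈ S.E
  · simp only [ha, true_and, ← utility_lt_iff ha h, ← utility_eq_iff ha h]
    grind
  · simp [ha, hz.2 _ ha]

theorem IsVec.isFractionalStable_iff {z : Sym2 V → ℝ} (hz : S.IsVec z) :
    IsFractionalStable S.utility (fun a b => z s(a, b)) ↔ S.C1 z ∧ S.C2 z := by
  have h2 : ∀ v w, s(v, w) ∈ S.E → xS z (S.simSet v s(v, w)) +
      (xS z (S.succSet v s(v, w)) + xS z (S.succSet w s(v, w))) =
        upperWeight S.utility (fun a b => z s(a, b)) v w +
          strictUpperWeight S.utility (fun a b => z s(a, b)) w v := by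
    intro v w h
    rw [← add_assoc, hz.xS_simSet_add_succSet h, Sym2.eq_swap,
      hz.xS_succSet (by rwa [Sym2.eq_swap])]
  constructor
  · intro h
    refine ⟨fun v => ?_, fun v w hvw => ?_⟩
    · rw [hz.xS_inc]
      exact h.degree_le v
    · rw [h2 v w hvw]
      exact h.stable v w (utility_pos_iff.2 hvw)
  · rintro ⟨h1, h3⟩
    refine ⟨fun a b => hz.1 _, fun a b => by rw [Sym2.eq_swap], fun a b h => ?_, fun a => ?_,
      fun a b h => ?_⟩
    · rw [utility_pos_iff]
      by_contra he
      exact h.ne' (hz.2 _ he)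
    · rw [← hz.xS_inc]
      exact h1 a
    · rw [← h2 a b (utility_pos_iff.1 h)]
      exact h3 a b (utility_pos_iff.1 h)

theorem IsVec.two_mul_xS_esub {z : Sym2 V → ℝ} (hz : S.IsVec z) (X : Finset V) :
    2 * xS z (S.esub X) = ∑ a ∈ X, ∑ b ∈ X, z s(a, b) := by
  classical
  have h1 : ∀ a ∈ X, ∑ b ∈ X, z s(a, b) = ∑ e ∈ S.esub X, if a ∈ e then z e else 0 := by
    intro a ha
    have h : (S.esub X).filter (fun e => a ∈ e) =
        (inc S.E a).filter fun e => ∀ u ∈ e, u ∈ X := by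
      ext e
      simp only [esub, inc, Finset.mem_filter]
      tauto
    rw [← Finset.sum_filter, h, sum_inc_filter]
    refine Finset.sum_subset_zero_on_sdiff (Finset.subset_univ X) (fun b hb => if_neg fun h => ?_)
      fun b hb => ?_
    · exact (Finset.mem_sdiff.1 hb).2 (h.2 b (Sym2.mem_mk_right a b))
    · have := hz.2 s(a, b)
      simp only [Sym2.mem_iff, forall_eq_or_imp, forall_eq, ha, hb, and_self, and_true]
      grind
  rw [Finset.sum_congr rfl h1, Finset.sum_comm, xS, Finset.mul_sum]
  refine Finset.sum_congr rfl fun e he => ?_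
  obtain ⟨heE, heX⟩ := Finset.mem_filter.1 he
  induction e with | _ p q
  have hpq : p ≠ q := fun h => S.not_diag _ heE h
  have h2 : X.filter (fun a => a ∈ s(p, q)) = {p, q} := by
    ext a
    simp only [Finset.mem_filter, Sym2.mem_iff, Finset.mem_insert, Finset.mem_singleton]
    have := heX p (Sym2.mem_mk_left p q)
    have := heX q (Sym2.mem_mk_right p q)
    grind
  rw [← Finset.sum_filter, h2, Finset.sum_const, Finset.card_pair hpq, nsmul_eq_mul]
  norm_num

theorem IsVec.sum_sum_le_of_C3 {z : Sym2 V → ℝ} (hz : S.IsVec z) (h : S.C3 z) (X : Finset V)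
    (hX : Odd X.card) : ∑ a ∈ X, ∑ b ∈ X, z s(a, b) ≤ X.card - 1 := by
  have h1 := h X hX
  rw [← hz.two_mul_xS_esub]
  have h2 : 2 * ((X.card / 2 : ℕ) : ℝ) + 1 = X.card := by
    exact_mod_cast Nat.two_mul_div_two_add_one_of_odd hX
  linarith

omit [Fintype V] in
theorem IsMateOf.chi_eq (hm : IsMateOf μ m) : (fun a b => chi μ s(a, b)) = mateWeight m := by
  classical
  ext a b
  rw [chi, mateWeight]
  by_cases h : m a = b ∧ a ≠ b
  · rw [if_pos h, if_pos ((hm a b).2 h)]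
  · rw [if_neg h, if_neg (mt (hm a b).1 h)]

theorem isVec_chi (hμ : μ ⊆ S.E) : S.IsVec (chi μ) :=
  ⟨fun e => by unfold chi; split_ifs <;> norm_num, fun _ he => if_neg fun h => he (hμ h)⟩

theorem IsMateOf.memP_chi (hm : IsMateOf μ m) (hinv : Function.Involutive m)
    (hμ : S.StronglyStable μ) : S.memP (chi μ) := by
  have hvec := isVec_chi hμ.1.1
  have hfrac : IsFractionalStable S.utility (fun a b => chi μ s(a, b)) := by
    rw [hm.chi_eq]
    refine isFractionalStable_mateWeight utility_self utility_pos_symm hinv (fun a ha => ?_)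
      ((hm.stronglyStable_iff hμ.1).1 hμ)
    exact utility_pos_iff.2 (hμ.1.1 ((hm a (m a)).2 ⟨rfl, ha.symm⟩))
  obtain ⟨h1, h2⟩ := hvec.isFractionalStable_iff.1 hfrac
  refine ⟨hvec, h1, h2, fun X _ => ?_⟩
  have h3 : 2 * xS (chi μ) (S.esub X) ≤ X.card := by
    rw [hvec.two_mul_xS_esub]
    refine (Finset.sum_le_card_nsmul X _ 1 fun a _ => ?_).trans (by simp)
    exact (Finset.sum_le_sum_of_subset_of_nonneg (Finset.subset_univ X)
      fun b _ _ => hvec.1 _).trans (hfrac.degree_le a)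
  have h4 : xS (chi μ) (S.esub X) = ((S.esub X).filter (· ∈ μ)).card := by
    simp only [xS, chi, Finset.sum_boole]
  rw [h4] at h3 ⊢
  have h5 : 2 * ((S.esub X).filter (· ∈ μ)).card ≤ X.card := by exact_mod_cast h3
  exact_mod_cast (by omega : ((S.esub X).filter (· ∈ μ)).card ≤ X.card / 2)

theorem mem_V1_of_mem {v : V} (hm : IsMateOf μ m) (hP : S.memP (chi μ)) (hv : m v ≠ v) :
    v ∈ S.V1 := by
  refine ⟨chi μ, hP, ?_⟩
  have h1 := congrFun hm.chi_eq v
  have h2 := sum_mateWeight_univ m v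
  rw [← h1, if_neg hv] at h2
  rw [hP.1.xS_inc, h2]
  exact one_pos

theorem mem_inc_supp_iff {x : Sym2 V → ℝ} (hx : S.IsVec x) {v a : V} :
    s(v, a) ∈ inc (S.supp x) v ↔ 0 < x s(v, a) := by
  have := hx.2 s(v, a)
  simp only [inc, supp, Finset.mem_filter, Sym2.mem_iff, true_or, and_true, and_iff_right_iff_imp]
  grind

theorem IsVec.mem_of_pos {x : Sym2 V → ℝ} (hx : S.IsVec x) {e : Sym2 V} (h : 0 < x e) :
    e ∈ S.E := by
  by_contra he
  exact h.ne' (hx.2 e he)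

theorem forall_mem_inc_supp {x : Sym2 V → ℝ} (hx : S.IsVec x) {v : V} {p : Sym2 V → Prop} :
    (∀ f ∈ inc (S.supp x) v, p f) ↔ ∀ c, 0 < x s(v, c) → p s(v, c) := by
  refine ⟨fun h c hc => h _ ((mem_inc_supp_iff hx).2 hc), fun h f hf => ?_⟩
  obtain ⟨c, rfl⟩ := Sym2.mem_iff_exists.1 (Finset.mem_filter.1 hf).2
  exact h c ((mem_inc_supp_iff hx).1 hf)

theorem mem_Bset_iff {x : Sym2 V → ℝ} (hx : S.IsVec x) {v a : V} :
    s(v, a) ∈ S.Bset x v ↔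
      0 < x s(v, a) ∧ IsBestIn S.utility (fun a b => x s(a, b)) v a := by
  classical
  rw [Bset, Finset.mem_filter, forall_mem_inc_supp hx, mem_inc_supp_iff hx]
  refine and_congr_right fun ha => forall₂_congr fun c hc => ?_
  rw [utility_le_iff (hx.mem_of_pos ha) (hx.mem_of_pos hc)]

theorem mem_Wset_iff {x : Sym2 V → ℝ} (hx : S.IsVec x) {v a : V} :
    s(v, a) ∈ S.Wset x v ↔
      0 < x s(v, a) ∧ IsWorstIn S.utility (fun a b => x s(a, b)) v a := by
  classical
  rw [Wset, Finset.mem_filter, forall_mem_inc_supp hx, mem_inc_supp_iff hx]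
  refine and_congr_right fun ha => forall₂_congr fun c hc => ?_
  rw [utility_le_iff (hx.mem_of_pos hc) (hx.mem_of_pos ha)]

theorem forall_mem_Bset_sPref {x : Sym2 V → ℝ} (hx : S.IsVec x) {v : V}
    (hv : s(v, m v) ∈ S.E) (h : HasBetter S.utility (fun a b => x s(a, b)) m v) :
    ∀ f ∈ S.Bset x v, S.SPref v (some f) (some s(v, m v)) := by
  classical
  intro f hf
  obtain ⟨a, rfl⟩ := Sym2.mem_iff_exists.1 (Finset.mem_filter.1 (Finset.mem_filter.1 hf).1).2
  obtain ⟨ha, hbest⟩ := (mem_Bset_iff hx).1 hf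
  obtain ⟨c, hc, hlt⟩ := h
  exact (utility_lt_iff (hx.mem_of_pos ha) hv).1 (hlt.trans_le (hbest c hc))

theorem forall_mem_Wset_sPref {x : Sym2 V → ℝ} (hx : S.IsVec x) {v : V}
    (hv : s(v, m v) ∈ S.E) (h : HasWorse S.utility (fun a b => x s(a, b)) m v) :
    ∀ f ∈ S.Wset x v, S.SPref v (some s(v, m v)) (some f) := by
  classical
  intro f hf
  obtain ⟨a, rfl⟩ := Sym2.mem_iff_exists.1 (Finset.mem_filter.1 (Finset.mem_filter.1 hf).1).2
  obtain ⟨ha, hworst⟩ := (mem_Wset_iff hx).1 hf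
  obtain ⟨c, hc, hlt⟩ := h
  exact (utility_lt_iff hv (hx.mem_of_pos ha)).1 ((hworst c hc).trans_lt hlt)

end Translation

end RSetup

end StronglyStableMates

open RSetup in
/-- if `P ≠ ∅`, `x ∈ P`, and a strongly stable matching exists,
then there is a strongly stable matching `μ` with `χ_μ ∈ P(T_x)`. -/
theorem exists_stronglyStable_in_Tset
    {V : Type*} [Fintype V] [DecidableEq V] (S : RSetup V)
    (hP : ∃ y : Sym2 V → ℝ, S.memP y)
    (x : Sym2 V → ℝ) (hx : S.memP x)
    (hσ : ∃ σ : Finset (Sym2 V), S.StronglyStable σ) :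
    ∃ μ : Finset (Sym2 V), S.StronglyStable μ ∧ S.memPF (S.Tset x) (chi μ) := by
  classical
  obtain ⟨σ, hσ⟩ := hσ
  obtain ⟨hvec, h1, h2, h3⟩ := hx
  obtain ⟨s, hs, hsσ⟩ := hσ.1.exists_mate
  obtain ⟨m, hm, hadj, hstable, hT⟩ :=
    (hvec.isFractionalStable_iff.2 ⟨h1, h2⟩).exists_stableMate utility_self utility_pos_symm
      (hvec.sum_sum_le_of_C3 h3) hs
      (fun a ha => utility_pos_iff.2 (hσ.1.1 ((hsσ a (s a)).2 ⟨rfl, ha.symm⟩)))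
      ((hsσ.stronglyStable_iff hσ.1).1 hσ)
  obtain ⟨μ, hμ, hmμ⟩ := exists_isMatching_of_mate hm fun a ha => utility_pos_iff.1 (hadj a ha)
  have hμs := (hmμ.stronglyStable_iff hμ).2 hstable
  have hμP := hmμ.memP_chi hm hμs
  refine ⟨μ, hμs, hμP, fun e he heT => if_neg fun heμ => heT ?_⟩
  have hmate : ∀ v ∈ e, e = s(v, m v) ∧ m v ≠ v := by
    intro v hv
    obtain ⟨a, rfl⟩ := Sym2.mem_iff_exists.1 hv
    obtain ⟨rfl, h⟩ := (hmμ v a).1 heμ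
    exact ⟨rfl, h.symm⟩
  rw [Tset, Finset.mem_filter, Finset.mem_filter]
  refine ⟨⟨he, fun v hv => mem_V1_of_mem hmμ hμP (hmate v hv).2⟩, fun v hv => ?_⟩
  obtain ⟨rfl, hmv⟩ := hmate v hv
  rw [Finset.mem_union, mem_Bset_iff hvec, mem_Wset_iff hvec]
  rcases hT v hmv with ⟨hpos, hbw⟩ | ⟨hB, hW⟩
  · exact Or.inl (hbw.imp (And.intro hpos) (And.intro hpos))
  · exact Or.inr ⟨forall_mem_Bset_sPref hvec he hB, forall_mem_Wset_sPref hvec he hW⟩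
end

section
/- Let G=(V,E) be a finite simple undirected graph with preferences as described, and assume P≠∅. Let z∈P, let f∈E_z be an edge with z(f)≠1, let v be a vertex of f, and let g∈W_z(v). If z'∈P(T_z) satisfies z'(g)=1 or z'(g)=0, then T_{z'} ≠ T_z. -/
namespace RSetup

theorem mem_inc {V : Type*} [DecidableEq V] {F : Finset (Sym2 V)} {v : V} {e : Sym2 V} :
    e ∈ inc F v ↔ e ∈ F ∧ v ∈ e := Finset.mem_filter

variable {V : Type*} [Fintype V] [DecidableEq V] (S : RSetup V)

theorem mem_supp {x : Sym2 V → ℝ} {e : Sym2 V} : e ∈ S.supp x ↔ e ∈ S.E ∧ 0 < x e :=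
  Finset.mem_filter

theorem mem_Bset {x : Sym2 V → ℝ} {v : V} {e : Sym2 V} :
    e ∈ S.Bset x v ↔ e ∈ inc (S.supp x) v ∧
      ∀ f ∈ inc (S.supp x) v, S.pref v (some e) (some f) := by
  simp only [Bset, Finset.mem_filter]

theorem mem_Wset {x : Sym2 V → ℝ} {v : V} {e : Sym2 V} :
    e ∈ S.Wset x v ↔ e ∈ inc (S.supp x) v ∧
      ∀ f ∈ inc (S.supp x) v, S.pref v (some f) (some e) := by
  simp only [Wset, Finset.mem_filter]

theorem mem_Tset {x : Sym2 V → ℝ} {e : Sym2 V} :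
    e ∈ S.Tset x ↔ (e ∈ S.E ∧ ∀ u ∈ e, u ∈ S.V1) ∧ ∀ v ∈ e,
      (e ∈ S.Bset x v ∪ S.Wset x v) ∨
        ((∀ f ∈ S.Bset x v, S.SPref v (some f) (some e)) ∧
          (∀ f ∈ S.Wset x v, S.SPref v (some e) (some f))) := by
  simp only [Tset, Finset.mem_filter]

theorem inc_supp_subset (x : Sym2 V → ℝ) (v : V) : inc (S.supp x) v ⊆ inc S.E v :=
  Finset.filter_subset_filter _ (Finset.filter_subset _ _)

theorem pref_total_inc {v : V} {e f : Sym2 V} (he : e ∈ inc S.E v) (hf : f ∈ inc S.E v) :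
    S.pref v (some e) (some f) ∨ S.pref v (some f) (some e) := by
  apply S.pref_total v
  · rintro _ ⟨rfl⟩
    exact mem_inc.1 he
  · rintro _ ⟨rfl⟩
    exact mem_inc.1 hf

theorem pref_trans_inc {v : V} {e f g : Sym2 V} (he : e ∈ inc S.E v) (hf : f ∈ inc S.E v)
    (hg : g ∈ inc S.E v) (hef : S.pref v (some e) (some f))
    (hfg : S.pref v (some f) (some g)) : S.pref v (some e) (some g) := by
  refine S.pref_trans v _ (some f) _ ?_ ?_ ?_ hef hfg
  · rintro _ ⟨rfl⟩
    exact mem_inc.1 he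
  · rintro _ ⟨rfl⟩
    exact mem_inc.1 hf
  · rintro _ ⟨rfl⟩
    exact mem_inc.1 hg

theorem exists_worst {v : V} {A : Finset (Sym2 V)} (hA : A.Nonempty) (hAE : A ⊆ inc S.E v) :
    ∃ e ∈ A, ∀ f ∈ A, S.pref v (some f) (some e) := by
  induction hA using Finset.Nonempty.cons_induction with
  | singleton a =>
    have ha := hAE (Finset.mem_singleton_self a)
    exact ⟨a, by simp, by simpa using S.pref_total_inc ha ha⟩
  | cons a s h hs ih =>
    have ha : a ∈ inc S.E v := hAE (by simp)
    have hsE : s ⊆ inc S.E v := fun e he => hAE (by simp [he])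
    obtain ⟨e, he, hmin⟩ := ih hsE
    rcases S.pref_total_inc ha (hsE he) with hae | hea
    · exact ⟨e, by simp [he], by simpa using ⟨hae, hmin⟩⟩
    · refine ⟨a, by simp, ?_⟩
      have haa := S.pref_total_inc ha ha
      simp only [Finset.mem_cons, forall_eq_or_imp]
      exact ⟨by simpa using haa,
        fun f hf => S.pref_trans_inc (hsE hf) (hsE he) ha (hmin f hf) hea⟩

theorem Wset_nonempty {x : Sym2 V → ℝ} {v : V} (h : (inc (S.supp x) v).Nonempty) :
    (S.Wset x v).Nonempty := by
  obtain ⟨e, he, hmin⟩ := S.exists_worst h (S.inc_supp_subset x v)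
  exact ⟨e, S.mem_Wset.2 ⟨he, hmin⟩⟩

open Classical in
/-- The weight with which `f` beats `e` at `v`: `1` for strict preference, `1/2` for a tie. -/
noncomputable def beat (v : V) (f e : Sym2 V) : ℝ :=
  if S.SPref v (some f) (some e) then 1 else if S.IPref v (some f) (some e) then 1 / 2 else 0

theorem beat_add_beat {v : V} {e f : Sym2 V} (he : e ∈ inc S.E v) (hf : f ∈ inc S.E v) :
    S.beat v f e + S.beat v e f = 1 := by
  have h := S.pref_total_inc he hf
  by_cases h1 : S.pref v (some e) (some f) <;> by_cases h2 : S.pref v (some f) (some e) <;>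
    norm_num [beat, SPref, IPref, h1, h2] <;> simp_all

theorem sum_beat (x : Sym2 V → ℝ) (v : V) (e : Sym2 V) :
    ∑ f ∈ inc S.E v, x f * S.beat v f e
      = xS x (S.succSet v e) + xS x (S.simSet v e) / 2 := by
  classical
  simp only [xS, succSet, simSet, Finset.sum_filter, Finset.sum_div, ← Finset.sum_add_distrib]
  refine Finset.sum_congr rfl fun f _ => ?_
  by_cases h1 : S.pref v (some e) (some f) <;> by_cases h2 : S.pref v (some f) (some e) <;>
    simp [beat, SPref, IPref, h1, h2, div_eq_mul_inv]

theorem sum_vertices_of_edge {e : Sym2 V} (he : e ∈ S.E) (φ : V → ℝ) :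
    ∃ a b, e = s(a, b) ∧ ∑ v, (if v ∈ e then φ v else 0) = φ a + φ b := by
  induction e using Sym2.ind with
  | _ a b =>
    have hab : a ≠ b := by simpa using S.not_diag _ he
    refine ⟨a, b, rfl, ?_⟩
    rw [← Finset.sum_filter, ← Finset.sum_pair hab]
    congr 1
    ext u
    simp

theorem sum_inc_comm (φ : V → Sym2 V → ℝ) :
    ∑ v, ∑ e ∈ inc S.E v, φ v e = ∑ e ∈ S.E, ∑ v, if v ∈ e then φ v e else 0 := by
  simp only [inc, Finset.sum_filter]
  exact Finset.sum_comm

theorem sum_degree (y : Sym2 V → ℝ) : ∑ v, xS y (inc S.E v) = 2 * ∑ e ∈ S.E, y e := by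
  simp only [xS]
  rw [S.sum_inc_comm fun _ e => y e, Finset.mul_sum]
  refine Finset.sum_congr rfl fun e he => ?_
  obtain ⟨a, b, -, h⟩ := S.sum_vertices_of_edge he fun _ => y e
  rw [h]
  ring

theorem sum_le_sum_beat {x y : Sym2 V → ℝ} (hx : S.memP x) (hy : S.memP y) :
    ∑ e ∈ S.E, y e
      ≤ ∑ v, ∑ e ∈ inc S.E v, ∑ f ∈ inc S.E v, y e * x f * S.beat v f e := by
  rw [S.sum_inc_comm fun v e => ∑ f ∈ inc S.E v, y e * x f * S.beat v f e]
  refine Finset.sum_le_sum fun e he => ?_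
  obtain ⟨a, b, rfl, h⟩ := S.sum_vertices_of_edge he
    fun v => ∑ f ∈ inc S.E v, y e * x f * S.beat v f e
  rw [h]
  simp only [mul_assoc, ← Finset.mul_sum, sum_beat]
  have h1 := hx.2.2.1 a b he
  have h2 := hx.2.2.1 b a (Sym2.eq_swap ▸ he)
  rw [Sym2.eq_swap (a := b) (b := a)] at h2
  nlinarith [hy.1.1 s(a, b)]

/-- All points of `P` saturate the same vertices and miss the others entirely. -/
theorem xS_inc_eq_one {x y : Sym2 V → ℝ} (hx : S.memP x) (hy : S.memP y) {v : V}
    (hv : 0 < xS y (inc S.E v)) : xS x (inc S.E v) = 1 := by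
  have hdeg (u : V) : xS y (inc S.E u) * xS x (inc S.E u)
      = (∑ e ∈ inc S.E u, ∑ f ∈ inc S.E u, y e * x f * S.beat u f e)
        + ∑ e ∈ inc S.E u, ∑ f ∈ inc S.E u, x e * y f * S.beat u f e := by
    rw [Finset.sum_comm (f := fun e f => x e * y f * S.beat u f e), xS, xS,
      Finset.sum_mul_sum, ← Finset.sum_add_distrib]
    refine Finset.sum_congr rfl fun e he => ?_
    rw [← Finset.sum_add_distrib]
    refine Finset.sum_congr rfl fun f hf => ?_
    linear_combination (- y e * x f) * S.beat_add_beat he hf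
  have hnonneg {w : Sym2 V → ℝ} (hw : S.memP w) (u : V) : 0 ≤ xS w (inc S.E u) :=
    Finset.sum_nonneg fun e _ => hw.1.1 e
  have hgap (u : V) : 0 ≤ xS y (inc S.E u) + xS x (inc S.E u)
      - 2 * (xS y (inc S.E u) * xS x (inc S.E u)) := by
    nlinarith [hnonneg hx u, hnonneg hy u, hx.2.1 u, hy.2.1 u]
  have hsum : ∑ u, (xS y (inc S.E u) + xS x (inc S.E u)
      - 2 * (xS y (inc S.E u) * xS x (inc S.E u))) ≤ 0 := by
    simp only [hdeg, Finset.sum_sub_distrib, Finset.sum_add_distrib, ← Finset.mul_sum,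
      sum_degree]
    linarith [S.sum_le_sum_beat hx hy, S.sum_le_sum_beat hy hx]
  have hzero := (Finset.sum_eq_zero_iff_of_nonneg fun u _ => hgap u).1
    (le_antisymm hsum (Finset.sum_nonneg fun u _ => hgap u)) v (Finset.mem_univ v)
  nlinarith [hnonneg hx v, hx.2.1 v, hy.2.1 v]

theorem mem_V1_of_mem_inc_supp {x : Sym2 V → ℝ} (hx : S.memP x) {v : V} {e : Sym2 V}
    (he : e ∈ inc (S.supp x) v) : v ∈ S.V1 :=
  ⟨x, hx, Finset.sum_pos' (fun e _ => hx.1.1 e)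
    ⟨e, S.inc_supp_subset x v he, (S.mem_supp.1 (mem_inc.1 he).1).2⟩⟩

theorem xS_inc_eq_one_of_mem_V1 {x : Sym2 V → ℝ} (hx : S.memP x) {v : V} (hv : v ∈ S.V1) :
    xS x (inc S.E v) = 1 := by
  obtain ⟨y, hy, hpos⟩ := hv
  exact S.xS_inc_eq_one hx hy hpos

theorem inc_supp_nonempty {x : Sym2 V → ℝ} (hx : S.memP x) {v : V} (hv : v ∈ S.V1) :
    (inc (S.supp x) v).Nonempty := by
  have h : 0 < xS x (inc S.E v) := by
    rw [S.xS_inc_eq_one_of_mem_V1 hx hv]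
    exact one_pos
  obtain ⟨e, he, hpos⟩ := Finset.exists_lt_of_sum_lt (f := fun _ => (0 : ℝ)) (by simpa [xS] using h)
  exact ⟨e, mem_inc.2 ⟨S.mem_supp.2 ⟨(mem_inc.1 he).1, hpos⟩, (mem_inc.1 he).2⟩⟩

theorem supp_subset_Tset {x : Sym2 V → ℝ} (hx : S.memP x) : S.supp x ⊆ S.Tset x := by
  intro e he
  have hinc {u : V} (hu : u ∈ e) : e ∈ inc (S.supp x) u := mem_inc.2 ⟨he, hu⟩
  refine S.mem_Tset.2 ⟨⟨(S.mem_supp.1 he).1,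
    fun u hu => S.mem_V1_of_mem_inc_supp hx (hinc hu)⟩, fun u hu => ?_⟩
  rw [or_iff_not_imp_left, Finset.mem_union, not_or]
  rintro ⟨hB, hW⟩
  constructor
  · intro f hf
    obtain ⟨hf, hbest⟩ := S.mem_Bset.1 hf
    exact ⟨hbest e (hinc hu), fun h => hB (S.mem_Bset.2 ⟨hinc hu, fun k hk =>
      S.pref_trans_inc (S.inc_supp_subset x u (hinc hu)) (S.inc_supp_subset x u hf)
        (S.inc_supp_subset x u hk) h (hbest k hk)⟩)⟩
  · intro f hf
    obtain ⟨hf, hworst⟩ := S.mem_Wset.1 hf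
    exact ⟨hworst e (hinc hu), fun h => hW (S.mem_Wset.2 ⟨hinc hu, fun k hk =>
      S.pref_trans_inc (S.inc_supp_subset x u hk) (S.inc_supp_subset x u hf)
        (S.inc_supp_subset x u (hinc hu)) (hworst k hk) h⟩)⟩

theorem pref_of_mem_Tset {x : Sym2 V → ℝ} {v : V} {g h : Sym2 V} (hg : g ∈ S.Wset x v)
    (hh : h ∈ S.Tset x) (hv : v ∈ h) : S.pref v (some h) (some g) := by
  rcases (S.mem_Tset.1 hh).2 v hv with hBW | hmid
  · rcases Finset.mem_union.1 hBW with hB | hW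
    · exact (S.mem_Bset.1 hB).2 g (S.mem_Wset.1 hg).1
    · exact (S.mem_Wset.1 hg).2 h (S.mem_Wset.1 hW).1
  · exact (hmid.2 g hg).1

theorem eq_of_mem_Tset_of_eq_one {x : Sym2 V → ℝ} (hx : S.memP x) {v : V} {g h : Sym2 V}
    (hg : g ∈ inc S.E v) (hxg : x g = 1) (hh : h ∈ S.Tset x) (hv : v ∈ h) : h = g := by
  have huniq : ∀ k ∈ inc (S.supp x) v, k = g := by
    intro k hk
    by_contra hne
    have hle : ∑ e ∈ {k, g}, x e ≤ xS x (inc S.E v) := by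
      refine Finset.sum_le_sum_of_subset_of_nonneg ?_ fun e _ _ => hx.1.1 e
      rw [Finset.insert_subset_iff, Finset.singleton_subset_iff]
      exact ⟨S.inc_supp_subset x v hk, hg⟩
    rw [Finset.sum_pair hne, hxg] at hle
    linarith [hx.2.1 v, (S.mem_supp.1 (mem_inc.1 hk).1).2]
  have hgs : g ∈ inc (S.supp x) v :=
    mem_inc.2 ⟨S.mem_supp.2 ⟨(mem_inc.1 hg).1, by simp [hxg]⟩, (mem_inc.1 hg).2⟩
  have hgg : S.pref v (some g) (some g) := by simpa using S.pref_total_inc hg hg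
  have hW : g ∈ S.Wset x v := S.mem_Wset.2 ⟨hgs, fun k hk => by rwa [huniq k hk]⟩
  have hB : g ∈ S.Bset x v := S.mem_Bset.2 ⟨hgs, fun k hk => by rwa [huniq k hk]⟩
  rcases (S.mem_Tset.1 hh).2 v hv with hBW | hmid
  · rcases Finset.mem_union.1 hBW with h' | h'
    · exact huniq h (S.mem_Bset.1 h').1
    · exact huniq h (S.mem_Wset.1 h').1
  · exact absurd (hmid.1 g hB).1 (hmid.2 g hW).2

end RSetup

open RSetup in
/-- let `z ∈ P`, `f ∈ E_z` with `z(f) ≠ 1`, `v ∈ f`, and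
`g ∈ W_z(v)`. If `z' ∈ P(T_z)` satisfies `z'(g) = 1` or `z'(g) = 0`, then
`T_{z'} ≠ T_z`. -/
theorem Tset_ne_of_extreme_value
    {V : Type*} [Fintype V] [DecidableEq V] (S : RSetup V)
    (hP : ∃ y : Sym2 V → ℝ, S.memP y)
    (z : Sym2 V → ℝ) (hz : S.memP z)
    (f : Sym2 V) (hf : f ∈ S.supp z) (hf1 : z f ≠ 1)
    (v : V) (hv : v ∈ f)
    (g : Sym2 V) (hg : g ∈ S.Wset z v)
    (z' : Sym2 V → ℝ) (hz' : S.memPF (S.Tset z) z')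
    (hval : z' g = 1 ∨ z' g = 0) :
    S.Tset z' ≠ S.Tset z := by
  intro hT
  have hfv : f ∈ inc (S.supp z) v := mem_inc.2 ⟨hf, hv⟩
  have hvV := S.mem_V1_of_mem_inc_supp hz hfv
  have hgs := (S.mem_Wset.1 hg).1
  have hgv := (mem_inc.1 hgs).2
  rcases hval with h1 | h0
  · have huniq : ∀ e ∈ inc (S.supp z) v, e = g := fun e he =>
      S.eq_of_mem_Tset_of_eq_one hz'.1 (S.inc_supp_subset z v hgs) h1
        (hT ▸ S.supp_subset_Tset hz (mem_inc.1 he).1) (mem_inc.1 he).2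
    refine hf1 ?_
    rw [← S.xS_inc_eq_one_of_mem_V1 hz hvV, xS,
      Finset.sum_eq_single_of_mem f (S.inc_supp_subset z v hfv)]
    intro e he hne
    by_contra h0
    have hes : e ∈ inc (S.supp z) v := mem_inc.2 ⟨S.mem_supp.2
      ⟨(mem_inc.1 he).1, lt_of_le_of_ne (hz.1.1 e) (Ne.symm h0)⟩, (mem_inc.1 he).2⟩
    exact hne ((huniq e hes).trans (huniq f hfv).symm)
  · have hgT : g ∈ S.Tset z' := hT ▸ S.supp_subset_Tset hz (mem_inc.1 hgs).1
    have hgn : g ∉ inc (S.supp z') v := fun h =>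
      (S.mem_supp.1 (mem_inc.1 h).1).2.ne' h0
    obtain ⟨h, hh⟩ := S.Wset_nonempty (S.inc_supp_nonempty hz'.1 hvV)
    have hhs := mem_inc.1 (S.mem_Wset.1 hh).1
    have hhT : h ∈ S.Tset z := by
      by_contra hn
      exact (S.mem_supp.1 hhs.1).2.ne' (hz'.2 h (S.mem_supp.1 hhs.1).1 hn)
    rcases (S.mem_Tset.1 hgT).2 v hgv with hBW | hmid
    · rcases Finset.mem_union.1 hBW with h' | h'
      · exact hgn (S.mem_Bset.1 h').1
      · exact hgn (S.mem_Wset.1 h').1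
    · exact (hmid.2 h hh).2 (S.pref_of_mem_Tset hg hhT hhs.2)
end
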